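/- Let d ≥ 1, η > 0, D > 0 and δ ∈ (0,1). Let P be a probability distribution on B_1^d × [−D,D] whose marginal in x is Uniform(B_1^d). There exist constants c > 0 and a ≥ 0 depending only on d such that: if (x_1,y_1),…,(x_n,y_n) are drawn i.i.d. from P, then with probability at least 1−δ, every f_θ ∈ F_stable(η) (stable minima for the empirical loss on this dataset) satisfies |E_{(x,y)∼P}[(f_θ(x)−y)²] − (1/n)Σ_{i=1}^n (f_θ(x_i)−y_i)²| ≤ c (1 + log n + log(1/δ))^a (1/η − 1/2 + 4M)^{d/(d²+4d+3)} M^{3(d+2)/(d+3)} n^{−1/(2d+2)}, where M = max{D, ‖f_θ‖_{L∞(B_1^d)}, 1}. -/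

import Mathlib

open MeasureTheory Real Filter ProbabilityTheory
open scoped ENNReal Classical BigOperators

noncomputable section

abbrev Euc (d : ℕ) : Type := EuclideanSpace ℝ (Fin d)

def relu (t : ℝ) : ℝ := max t 0

abbrev ParamIx (d K : ℕ) : Type := (Fin K × Fin d) ⊕ (Fin K ⊕ (Fin K ⊕ Unit))

abbrev Params (d K : ℕ) : Type := EuclideanSpace ℝ (ParamIx d K)

/-- input-layer weight `w_k j` -/
def wP {d K : ℕ} (θ : Params d K) (k : Fin K) (j : Fin d) : ℝ := θ (Sum.inl (k, j))
/-- input-layer bias `b_k` -/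
def bP {d K : ℕ} (θ : Params d K) (k : Fin K) : ℝ := θ (Sum.inr (Sum.inl k))
/-- output-layer weight `v_k` -/
def vP {d K : ℕ} (θ : Params d K) (k : Fin K) : ℝ := θ (Sum.inr (Sum.inr (Sum.inl k)))
/-- output bias `β` -/
def betaP {d K : ℕ} (θ : Params d K) : ℝ := θ (Sum.inr (Sum.inr (Sum.inr ())))

/-- two-layer ReLU network `f_θ(x) = Σ_k v_k relu(w_kᵀ x − b_k) + β` -/
def netFun {d K : ℕ} (θ : Params d K) (x : Euc d) : ℝ :=
  (∑ k, vP θ k * relu ((∑ j, wP θ k j * x j) - bP θ k)) + betaP θ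

/-- empirical squared loss -/
def empLoss {d K : ℕ} (n : ℕ) (x : Fin n → Euc d) (y : Fin n → ℝ) (θ : Params d K) : ℝ :=
  (1 / (2 * (n : ℝ))) * ∑ i, (y i - netFun θ (x i)) ^ 2

/-- Hessian quadratic form `vᵀ ∇²L(θ) v` -/
def hessQF {E : Type*} [NormedAddCommGroup E] [NormedSpace ℝ E] (L : E → ℝ) (θ v : E) : ℝ :=
  iteratedFDeriv ℝ 2 L θ ![v, v]

/-- largest eigenvalue of the (symmetric) Hessian of `L` at `θ` -/
def lambdaMax {E : Type*} [NormedAddCommGroup E] [NormedSpace ℝ E] (L : E → ℝ) (θ : E) : ℝ :=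
  ⨆ v : {v : E // ‖v‖ = 1}, hessQF L θ v.1

/-- weighted variation seminorm -/
def VgSeminorm (d : ℕ) (R : ℝ) (g : Euc d × ℝ → ℝ) (f : Euc d → ℝ) : ℝ≥0∞ :=
  sInf { m : ℝ≥0∞ |
    ∃ (ν : MeasureTheory.SignedMeasure (Euc d × ℝ)) (c : Euc d) (c₀ : ℝ),
      ν.totalVariation ((Metric.sphere (0 : Euc d) 1 ×ˢ Set.Icc (-R) R)ᶜ) = 0 ∧
      (∀ x ∈ Metric.closedBall (0 : Euc d) R,
        f x = (∫ p : Euc d × ℝ, relu ((∑ j, p.1 j * x j) - p.2)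
                  ∂ν.toJordanDecomposition.posPart)
              - (∫ p : Euc d × ℝ, relu ((∑ j, p.1 j * x j) - p.2)
                  ∂ν.toJordanDecomposition.negPart)
              + (∑ j, c j * x j) + c₀) ∧
      m = ∫⁻ p, ENNReal.ofReal (g p) ∂ν.totalVariation }

def gTilde {d : ℕ} (n : ℕ) (x : Fin n → Euc d) (u : Euc d) (t : ℝ) : ℝ :=
  (((Finset.univ.filter fun i => t < ∑ j, u j * x i j).card : ℝ) / (n : ℝ)) ^ 2 *
    ((∑ i ∈ Finset.univ.filter fun i => t < ∑ j, u j * x i j, ((∑ j, u j * x i j) - t)) /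
      ((Finset.univ.filter fun i => t < ∑ j, u j * x i j).card : ℝ)) *
    Real.sqrt (1 + ‖(((Finset.univ.filter fun i => t < ∑ j, u j * x i j).card : ℝ))⁻¹ •
      ∑ i ∈ Finset.univ.filter fun i => t < ∑ j, u j * x i j, x i‖ ^ 2)

def gData {d : ℕ} (n : ℕ) (x : Fin n → Euc d) : Euc d × ℝ → ℝ :=
  fun p => min (gTilde n x p.1 p.2) (gTilde n x (-p.1) (-p.2))

def gPow (d : ℕ) : Euc d × ℝ → ℝ :=
  fun p => if |p.2| ≤ 1 then (1 - |p.2|) ^ (d + 2) else 0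

def uniformBall (d : ℕ) : Measure (Euc d) :=
  (volume (Metric.closedBall (0 : Euc d) 1))⁻¹ • volume.restrict (Metric.closedBall 0 1)

instance (d : ℕ) : IsProbabilityMeasure (uniformBall d) := by
  constructor
  rw [uniformBall, Measure.smul_apply, Measure.restrict_apply MeasurableSet.univ,
    Set.univ_inter, smul_eq_mul, ENNReal.inv_mul_cancel]
  · exact (Metric.measure_closedBall_pos volume (0 : Euc d) one_pos).ne'
  · exact (isCompact_closedBall _ _).measure_lt_top.ne

/-- set of stable solutions for the dataset `(x, y)` -/
def FStable (d : ℕ) (η : ℝ) {n : ℕ} (x : Fin n → Euc d) (y : Fin n → ℝ) (f : Euc d → ℝ) : Prop :=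
  ∃ (K : ℕ) (θ : Params d K),
    (∀ z, f z = netFun θ z) ∧
    ContDiffAt ℝ 2 (empLoss n x y) θ ∧
    lambdaMax (empLoss n x y) θ ≤ 2 / η

/-- membership in the (unweighted) variation ball `V_C(B_1^d)` -/
def memVC (d : ℕ) (C : ℝ) (f : Euc d → ℝ) : Prop :=
  ∃ (ν : MeasureTheory.SignedMeasure (Euc d × ℝ)) (c : Euc d) (b : ℝ),
    ν.totalVariation ((Metric.sphere (0 : Euc d) 1 ×ˢ Set.Icc (-1 : ℝ) 1)ᶜ) = 0 ∧
    ν.totalVariation Set.univ ≤ ENNReal.ofReal C ∧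
    ∀ x ∈ Metric.closedBall (0 : Euc d) 1,
      f x = (∫ p : Euc d × ℝ, relu ((∑ j, p.1 j * x j) - p.2)
                ∂ν.toJordanDecomposition.posPart)
            - (∫ p : Euc d × ℝ, relu ((∑ j, p.1 j * x j) - p.2)
                ∂ν.toJordanDecomposition.negPart)
            + (∑ j, c j * x j) + b


lemma hessQF_of_quartic {E : Type*} [NormedAddCommGroup E] [NormedSpace ℝ E] (L : E → ℝ) (θ v : E)
    (hL : ContDiffAt ℝ 2 L θ) (c0 c1 c2 c3 c4 : ℝ)
    (h : ∀ᶠ s in nhdsWithin (0 : ℝ) (Set.Ioi 0),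
      L (θ + s • v) = c0 + c1 * s + c2 * s ^ 2 + c3 * s ^ 3 + c4 * s ^ 4) :
    hessQF L θ v = 2 * c2 := by
  have hcont : ContinuousAt (fun s : ℝ => θ + s • v) 0 := by fun_prop
  have hline : ∀ s : ℝ, HasDerivAt (fun s : ℝ => θ + s • v) v s := by
    intro s
    simpa using ((hasDerivAt_id s).smul_const v).const_add θ
  have hL' : ContDiffAt ℝ 1 (fderiv ℝ L) θ := hL.fderiv_right (by norm_num)
  have hL'' : ContinuousAt (fderiv ℝ (fderiv ℝ L)) θ :=
    (hL'.fderiv_right (m := 0) (by norm_num)).continuousAt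
  have h0 : θ + (0 : ℝ) • v = θ := by simp
  have e1 : ∀ᶠ s in nhds (0 : ℝ), ContDiffAt ℝ 2 L (θ + s • v) := by
    have := hL.eventually (by simp)
    rw [← h0] at this
    exact hcont.eventually this
  have d1 : ∀ᶠ s in nhds (0 : ℝ), HasDerivAt (fun s => L (θ + s • v)) (fderiv ℝ L (θ + s • v) v) s := by
    filter_upwards [e1] with s hs
    exact ((hs.differentiableAt (by norm_num)).hasFDerivAt).comp_hasDerivAt s (hline s)
  have d2 : ∀ᶠ s in nhds (0 : ℝ), HasDerivAt (fun s => fderiv ℝ L (θ + s • v) v)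
      (fderiv ℝ (fderiv ℝ L) (θ + s • v) v v) s := by
    filter_upwards [e1] with s hs
    have h1 : ContDiffAt ℝ 1 (fderiv ℝ L) (θ + s • v) := hs.fderiv_right (by norm_num)
    have h2 := ((h1.differentiableAt (by norm_num)).hasFDerivAt).comp_hasDerivAt s (hline s)
    exact h2.clm_apply (hasDerivAt_const s v) |>.congr_deriv (by simp)
  obtain ⟨s0, hs0, H⟩ := (mem_nhdsGT_iff_exists_Ioo_subset).1 (h.and ((d1.and d2).filter_mono nhdsWithin_le_nhds))
  have D1 : ∀ s ∈ Set.Ioo 0 s0, fderiv ℝ L (θ + s • v) v = c1 + 2 * c2 * s + 3 * c3 * s ^ 2 + 4 * c4 * s ^ 3 := by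
    intro s hs
    have A := (H hs).2.1
    have B : HasDerivAt (fun s : ℝ => c0 + c1 * s + c2 * s ^ 2 + c3 * s ^ 3 + c4 * s ^ 4)
      (c1 + 2 * c2 * s + 3 * c3 * s ^ 2 + 4 * c4 * s ^ 3) s := by
      have := ((((hasDerivAt_const s c0).add ((hasDerivAt_id s).const_mul c1)).add
        ((hasDerivAt_pow 2 s).const_mul c2)).add ((hasDerivAt_pow 3 s).const_mul c3)).add
        ((hasDerivAt_pow 4 s).const_mul c4)
      refine this.congr_deriv ?_
      norm_num; ring
    refine A.unique (B.congr_of_eventuallyEq ?_)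
    filter_upwards [isOpen_Ioo.mem_nhds hs] with t ht using (H ht).1
  have D2 : ∀ s ∈ Set.Ioo 0 s0, fderiv ℝ (fderiv ℝ L) (θ + s • v) v v = 2 * c2 + 6 * c3 * s + 12 * c4 * s ^ 2 := by
    intro s hs
    have A := (H hs).2.2
    have B : HasDerivAt (fun s : ℝ => c1 + 2 * c2 * s + 3 * c3 * s ^ 2 + 4 * c4 * s ^ 3)
      (2 * c2 + 6 * c3 * s + 12 * c4 * s ^ 2) s := by
      have := (((hasDerivAt_const s c1).add ((hasDerivAt_id s).const_mul (2 * c2))).add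
        ((hasDerivAt_pow 2 s).const_mul (3 * c3))).add ((hasDerivAt_pow 3 s).const_mul (4 * c4))
      refine this.congr_deriv ?_
      norm_num; ring
    refine A.unique (B.congr_of_eventuallyEq ?_)
    filter_upwards [isOpen_Ioo.mem_nhds hs] with t ht using D1 t ht
  have T1 : Tendsto (fun s : ℝ => fderiv ℝ (fderiv ℝ L) (θ + s • v) v v) (nhdsWithin 0 (Set.Ioi 0))
      (nhds (fderiv ℝ (fderiv ℝ L) θ v v)) := by
    have : ContinuousAt (fun s : ℝ => fderiv ℝ (fderiv ℝ L) (θ + s • v)) 0 := by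
      apply ContinuousAt.comp (f := fun s : ℝ => θ + s • v) _ hcont
      simpa using hL''
    have h3 := (this.clm_apply continuousAt_const (g := fun _ => v)).clm_apply
      (continuousAt_const (y := v))
    have h4 := h3.tendsto
    simp only [h0] at h4
    exact h4.mono_left nhdsWithin_le_nhds
  have T2 : Tendsto (fun s : ℝ => 2 * c2 + 6 * c3 * s + 12 * c4 * s ^ 2) (nhdsWithin 0 (Set.Ioi 0))
      (nhds (2 * c2)) := by
    have : ContinuousAt (fun s : ℝ => 2 * c2 + 6 * c3 * s + 12 * c4 * s ^ 2) 0 := by fun_prop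
    have := this.tendsto
    simp only [mul_zero, add_zero, ne_eq, OfNat.ofNat_ne_zero, not_false_eq_true, zero_pow] at this
    exact this.mono_left nhdsWithin_le_nhds
  have T3 := T1.congr' (f₂ := fun s : ℝ => 2 * c2 + 6 * c3 * s + 12 * c4 * s ^ 2) (by
    filter_upwards [Ioo_mem_nhdsGT hs0] with s hs using D2 s hs)
  rw [hessQF, iteratedFDeriv_two_apply]
  simpa using tendsto_nhds_unique T3 T2

lemma hessQF_le_lambdaMax {E : Type*} [NormedAddCommGroup E] [NormedSpace ℝ E] (L : E → ℝ) (θ v : E) :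
    hessQF L θ v ≤ lambdaMax L θ * ‖v‖ ^ 2 := by
  by_cases hv : v = 0
  · subst hv
    have : hessQF L θ 0 = 0 := by
      rw [hessQF]
      exact ContinuousMultilinearMap.map_coord_zero _ 0 (by simp)
    simp [this]
  have hn : ‖v‖ ≠ 0 := by simpa using hv
  have hb : BddAbove (Set.range fun v : {v : E // ‖v‖ = 1} => hessQF L θ v.1) := by
    refine ⟨‖iteratedFDeriv ℝ 2 L θ‖, ?_⟩
    rintro _ ⟨w, rfl⟩
    refine (le_abs_self _).trans ?_
    have := (iteratedFDeriv ℝ 2 L θ).le_opNorm ![w.1, w.1]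
    simpa [hessQF, Fin.prod_univ_two, w.2] using this
  have h1 : ‖(‖v‖⁻¹) • v‖ = 1 := by
    rw [norm_smul, norm_inv, norm_norm, inv_mul_cancel₀ hn]
  have h2 := le_ciSup hb ⟨_, h1⟩
  have h3 : hessQF L θ v = ‖v‖ ^ 2 * hessQF L θ ((‖v‖⁻¹) • v) := by
    rw [hessQF, hessQF, iteratedFDeriv_two_apply, iteratedFDeriv_two_apply]
    simp
    field_simp
  rw [h3, mul_comm]
  exact mul_le_mul_of_nonneg_right h2 (by positivity)

lemma relu_nonneg (t : ℝ) : 0 ≤ relu t := le_max_right _ _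

/-- one-sided slope of relu -/
def slopeA (z ζ : ℝ) : ℝ := if 0 < z then ζ else if z = 0 then relu ζ else 0

lemma relu_eventually (z ζ : ℝ) : ∀ᶠ s in nhdsWithin (0 : ℝ) (Set.Ioi 0),
    relu (z + s * ζ) = relu z + s * slopeA z ζ := by
  have hc : ContinuousAt (fun s : ℝ => z + s * ζ) 0 := by fun_prop
  rcases lt_trichotomy z 0 with h | h | h
  · have : ∀ᶠ s in nhds (0 : ℝ), z + s * ζ < 0 := hc.eventually_lt continuousAt_const (by simpa using h)
    filter_upwards [this.filter_mono nhdsWithin_le_nhds] with s hs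
    simp [relu, slopeA, h.not_gt, h.ne, max_eq_right h.le, max_eq_right hs.le]
  · subst h
    filter_upwards [self_mem_nhdsWithin] with s hs
    simp [relu, slopeA]
    rw [mul_max_of_nonneg _ _ (le_of_lt hs)]; simp
  · have : ∀ᶠ s in nhds (0 : ℝ), 0 < z + s * ζ := continuousAt_const.eventually_lt hc (by simpa using h)
    filter_upwards [this.filter_mono nhdsWithin_le_nhds] with s hs
    simp [relu, slopeA, h, max_eq_left h.le, max_eq_left hs.le]

/-- preactivation -/
def zP {d K n : ℕ} (x : Fin n → Euc d) (θ : Params d K) (k : Fin K) (i : Fin n) : ℝ :=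
  (∑ j, wP θ k j * x i j) - bP θ k

lemma stable_weight {d K n : ℕ} (hn : 0 < n) (x : Fin n → Euc d) (y : Fin n → ℝ) (θ : Params d K)
    (η κ : ℝ) (hη : 0 < η) (hκ : 0 ≤ κ) (hr : ∀ i, |y i - netFun θ (x i)| ≤ 2 * κ)
    (hC : ContDiffAt ℝ 2 (empLoss n x y) θ) (hl : lambdaMax (empLoss n x y) θ ≤ 2 / η) :
    ∑ k, |vP θ k| * ((1 / (n : ℝ)) * ∑ i, relu (zP x θ k i)) *
      ((1 / (n : ℝ)) * ∑ i, if 0 < zP x θ k i then (1 : ℝ) else 0) ≤ 1 / η + κ := by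
  have hn' : (0 : ℝ) < n := by exact_mod_cast hn
  set mr : Fin K → ℝ := fun k => (1 / (n : ℝ)) * ∑ i, relu (zP x θ k i) with hmr
  set pr : Fin K → ℝ := fun k => (1 / (n : ℝ)) * ∑ i, if 0 < zP x θ k i then (1 : ℝ) else 0 with hpr
  have mr0 : ∀ k, 0 ≤ mr k := fun k => mul_nonneg (by positivity)
    (Finset.sum_nonneg fun i _ => relu_nonneg _)
  have pr0 : ∀ k, 0 ≤ pr k := fun k => mul_nonneg (by positivity)
    (Finset.sum_nonneg fun i _ => by split_ifs <;> norm_num)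
  let v : Params d K := WithLp.toLp 2 (fun ix => match ix with
    | Sum.inl _ => 0
    | Sum.inr (Sum.inl k) => - (vP θ k * pr k)
    | Sum.inr (Sum.inr (Sum.inl k)) => mr k
    | Sum.inr (Sum.inr (Sum.inr _)) => 0)
  set V : ℝ := ∑ k, ((vP θ k * pr k) ^ 2 + mr k ^ 2) with hV
  have hvV : ‖v‖ ^ 2 = V := by
    rw [EuclideanSpace.real_norm_sq_eq]
    simp [v, Fintype.sum_sum_type, hV, Finset.sum_add_distrib]
  set a : Fin n → ℝ := fun i => ∑ k, (vP θ k * slopeA (zP x θ k i) (vP θ k * pr k) + mr k * relu (zP x θ k i)) with ha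
  set q : Fin n → ℝ := fun i => ∑ k, mr k * slopeA (zP x θ k i) (vP θ k * pr k) with hq
  set r : Fin n → ℝ := fun i => y i - netFun θ (x i) with hrd
  have hnet : ∀ᶠ s in nhdsWithin (0 : ℝ) (Set.Ioi 0), ∀ i,
      netFun (θ + s • v) (x i) = netFun θ (x i) + s * a i + s ^ 2 * q i := by
    have : ∀ᶠ s in nhdsWithin (0 : ℝ) (Set.Ioi 0), ∀ i, ∀ k,
      relu (zP x θ k i + s * (vP θ k * pr k)) = relu (zP x θ k i) + s * slopeA (zP x θ k i) (vP θ k * pr k) := by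
      rw [eventually_all]; intro i
      rw [eventually_all]; intro k
      exact relu_eventually _ _
    filter_upwards [this] with s hs i
    have e1 : ∀ k, (∑ j, wP (θ + s • v) k j * x i j) - bP (θ + s • v) k = zP x θ k i + s * (vP θ k * pr k) := by
      intro k
      simp [zP, wP, bP, v]
      ring
    have e2 : ∀ k, vP (θ + s • v) k = vP θ k + s * mr k := by
      intro k
      simp [vP, v]
    have e3 : betaP (θ + s • v) = betaP θ := by simp [betaP, v]
    simp only [netFun, e1, e2, e3, hs i, ha, hq, Finset.mul_sum]
    have e4 : ∀ k, relu ((∑ j, wP θ k j * x i j) - bP θ k) = relu (zP x θ k i) := fun k => rfl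
    simp only [e4]
    rw [add_right_comm _ (betaP θ), add_right_comm _ (betaP θ), ← Finset.sum_add_distrib, ← Finset.sum_add_distrib]
    congr 1
    apply Finset.sum_congr rfl
    intro k _
    ring
  have hH := hessQF_of_quartic (empLoss n x y) θ v hC
    ((1 / (2 * (n : ℝ))) * ∑ i, r i ^ 2) ((1 / (2 * (n : ℝ))) * ∑ i, (-2 * r i * a i))
    ((1 / (2 * (n : ℝ))) * ∑ i, (a i ^ 2 - 2 * r i * q i)) ((1 / (2 * (n : ℝ))) * ∑ i, (2 * a i * q i))
    ((1 / (2 * (n : ℝ))) * ∑ i, q i ^ 2) (by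
      filter_upwards [hnet] with s hs
      simp only [empLoss, hs]
      simp only [mul_assoc _ _ (s ^ _), mul_assoc _ _ s, ← mul_add, Finset.sum_mul, ← Finset.sum_add_distrib]
      congr 1
      apply Finset.sum_congr rfl
      intro i _
      simp only [hrd]
      ring)
  have hH2 := hessQF_le_lambdaMax (empLoss n x y) θ v
  rw [hH, hvV] at hH2
  have V0 : 0 ≤ V := Finset.sum_nonneg fun k _ => by positivity
  have hq' : ∀ i, |q i| ≤ V / 2 := by
    intro i
    refine (Finset.abs_sum_le_sum_abs _ _).trans ?_
    rw [hV, Finset.sum_div]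
    apply Finset.sum_le_sum
    intro k _
    have : |slopeA (zP x θ k i) (vP θ k * pr k)| ≤ |vP θ k * pr k| := by
      unfold slopeA relu
      split_ifs
      · exact le_rfl
      · rw [abs_of_nonneg (le_max_right _ _)]
        exact max_le (le_abs_self _) (abs_nonneg _)
      · simpa using abs_nonneg (vP θ k * pr k)
    rw [abs_mul, abs_of_nonneg (mr0 k), ← sq_abs (vP θ k * pr k)]
    nlinarith [mul_le_mul_of_nonneg_left this (mr0 k), sq_nonneg (mr k - |vP θ k * pr k|)]
  have hmean : V ≤ (1 / (n : ℝ)) * ∑ i, a i := by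
    have : (1 / (n : ℝ)) * ∑ i, a i = ∑ k, ((1 / (n : ℝ)) * (∑ i, vP θ k * slopeA (zP x θ k i) (vP θ k * pr k)) + mr k * mr k) := by
      simp only [ha]
      rw [Finset.sum_comm, Finset.mul_sum]
      apply Finset.sum_congr rfl
      intro k _
      rw [Finset.sum_add_distrib, mul_add, ← Finset.mul_sum _ _ (mr k)]
      congr 1
      simp only [hmr]; ring
    rw [this, hV]
    apply Finset.sum_le_sum
    intro k _
    have : (vP θ k * pr k) ^ 2 = (1 / (n : ℝ)) * ∑ i, vP θ k * ((vP θ k * pr k) * (if 0 < zP x θ k i then (1 : ℝ) else 0)) := by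
      rw [← Finset.mul_sum, ← Finset.mul_sum]
      have : ∑ i, (if 0 < zP x θ k i then (1 : ℝ) else 0) = n * pr k := by
        simp only [hpr]; field_simp
      rw [this]; field_simp
    rw [this, ← pow_two]
    refine add_le_add (mul_le_mul_of_nonneg_left (Finset.sum_le_sum fun i _ => ?_) (by positivity)) le_rfl
    unfold slopeA
    split_ifs with h1 h2
    · simp
    · simp only [mul_zero]
      unfold relu
      rcases le_total 0 (vP θ k) with h | h
      · exact mul_nonneg h (le_max_right _ _)
      · rw [max_eq_right (mul_nonpos_of_nonpos_of_nonneg h (pr0 k))]; simp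
    · simp
  have hsq : V ^ 2 ≤ (1 / (n : ℝ)) * ∑ i, a i ^ 2 := by
    have h1 := sq_sum_le_card_mul_sum_sq (s := Finset.univ) (f := a)
    simp only [Finset.card_univ, Fintype.card_fin] at h1
    calc V ^ 2 ≤ ((1 / (n : ℝ)) * ∑ i, a i) ^ 2 := by gcongr
      _ = (1 / (n : ℝ)) ^ 2 * (∑ i, a i) ^ 2 := by ring
      _ ≤ (1 / (n : ℝ)) ^ 2 * (n * ∑ i, a i ^ 2) := by gcongr
      _ = _ := by field_simp
  have hrq : (1 / (n : ℝ)) * ∑ i, 2 * r i * q i ≤ 2 * κ * V := by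
    calc (1 / (n : ℝ)) * ∑ i, 2 * r i * q i ≤ (1 / (n : ℝ)) * ∑ i : Fin n, 2 * κ * V := by
          refine mul_le_mul_of_nonneg_left (Finset.sum_le_sum fun i _ => ?_) (by positivity)
          have h1 : r i * q i ≤ |r i| * |q i| := by rw [← abs_mul]; exact le_abs_self _
          have h2 : |r i| * |q i| ≤ (2 * κ) * (V / 2) := mul_le_mul (hr i) (hq' i) (abs_nonneg _) (by positivity)
          linarith
      _ = _ := by simp; field_simp
  have hmain : V ^ 2 - 2 * κ * V ≤ 2 / η * V := by
    have h5 : 2 * ((1 / (2 * (n : ℝ))) * ∑ i, (a i ^ 2 - 2 * r i * q i)) = (1 / (n : ℝ)) * ∑ i, a i ^ 2 - (1 / (n : ℝ)) * ∑ i, 2 * r i * q i := by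
      rw [Finset.sum_sub_distrib]; field_simp
    rw [h5] at hH2
    have := mul_le_mul_of_nonneg_right hl V0
    linarith
  have hV2 : V ≤ 2 / η + 2 * κ := by
    rcases V0.eq_or_lt with h | h
    · rw [← h]; positivity
    · have : V * V ≤ (2 / η + 2 * κ) * V := by linarith
      exact le_of_mul_le_mul_right this h
  have hfin : 2 * ∑ k, |vP θ k| * mr k * pr k ≤ V := by
    rw [hV, Finset.mul_sum]
    apply Finset.sum_le_sum
    intro k _
    rw [← sq_abs (vP θ k * pr k), abs_mul, abs_of_nonneg (pr0 k)]
    nlinarith [sq_nonneg (|vP θ k| * pr k - mr k)]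
  have : 1 / η + κ = (2 / η + 2 * κ) / 2 := by ring
  rw [this]
  linarith

def lin {d : ℕ} (p : Fin (d + 1) → ℝ) (x : Euc d) : ℝ := p 0 + ∑ j : Fin d, p j.succ * x j

lemma lin_continuous {d : ℕ} (p : Fin (d + 1) → ℝ) : Continuous (lin p : Euc d → ℝ) := by
  unfold lin; fun_prop

lemma uniformBall_real {d : ℕ} (s : Set (Euc d)) (hs : MeasurableSet s) :
    (uniformBall d).real s = volume.real (s ∩ Metric.closedBall 0 1) / volume.real (Metric.closedBall (0 : Euc d) 1) := by
  simp only [Measure.real, uniformBall, Measure.smul_apply, Measure.restrict_apply hs, smul_eq_mul,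
    ENNReal.toReal_mul, ENNReal.toReal_inv]
  rw [div_eq_inv_mul]

lemma volB_pos (d : ℕ) : 0 < volume.real (Metric.closedBall (0 : Euc d) 1) :=
  ENNReal.toReal_pos (Metric.measure_closedBall_pos volume (0 : Euc d) one_pos).ne'
    (isCompact_closedBall _ _).measure_lt_top.ne

lemma volB_scale {d : ℕ} (r : ℝ) (hr : 0 ≤ r) (c : Euc d) : volume.real (Metric.closedBall c r)
    = r ^ d * volume.real (Metric.closedBall (0 : Euc d) 1) := by
  have := Measure.addHaar_real_closedBall' (volume : Measure (Euc d)) c hr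
  rw [this]
  simp

lemma unif_annulus {d : ℕ} (ε : ℝ) (h0 : 0 ≤ ε) (h1 : ε ≤ 1) :
    (uniformBall d).real {x | 1 - ε < ‖x‖} ≤ d * ε := by
  rw [uniformBall_real _ (measurableSet_lt measurable_const measurable_norm), div_le_iff₀ (volB_pos d)]
  have e : {x : Euc d | 1 - ε < ‖x‖} ∩ Metric.closedBall 0 1 = Metric.closedBall 0 1 \ Metric.closedBall 0 (1 - ε) := by
    ext x; simp [and_comm]
  rw [e, measureReal_sdiff (Metric.closedBall_subset_closedBall (by linarith)) Metric.isClosed_closedBall.measurableSet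
    (isCompact_closedBall _ _).measure_lt_top.ne, volB_scale (1 - ε) (by linarith)]
  have := one_add_mul_le_pow (a := -ε) (by linarith) d
  have h2 := volB_pos d
  rw [← sub_eq_add_neg] at this
  nlinarith [mul_le_mul_of_nonneg_right this h2.le]

lemma abs_coord_le {d : ℕ} (x : Euc d) (j : Fin d) : |x j| ≤ ‖x‖ := by
  simpa using PiLp.norm_apply_le x j

lemma unif_slab {d : ℕ} (q : Fin (d + 1) → ℝ) (hq : ∃ i, |q i| = 1) (ω : ℝ) (hω : 0 < ω) :
    (uniformBall d).real {x | |lin q x| ≤ ω} ≤ 12 * 2 ^ d * ω := by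
  have hp1 : (1 : ℝ) ≤ 2 ^ d := one_le_pow₀ (by norm_num)
  by_cases hω' : 1 / 6 < ω
  · refine measureReal_le_one.trans ?_
    nlinarith
  push Not at hω'
  have hmeas : MeasurableSet {x : Euc d | |lin q x| ≤ ω} :=
    measurableSet_le (lin_continuous q).measurable.abs measurable_const
  rw [uniformBall_real _ hmeas, div_le_iff₀ (volB_pos d)]
  set S : Set (Euc d) := {x : Euc d | |lin q x| ≤ ω} ∩ Metric.closedBall 0 1 with hS
  have hSm : MeasurableSet S := hmeas.inter Metric.isClosed_closedBall.measurableSet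
  let w : Euc d := WithLp.toLp 2 (fun j => q j.succ)
  have hlin : ∀ x : Euc d, lin q x = q 0 + inner ℝ w x := by
    intro x
    simp [lin, w, PiLp.inner_apply, mul_comm]
  have hB := volB_pos d
  by_cases hw : ‖w‖ < 1 / 2
  · have : S = ∅ := by
      ext x
      simp only [hS, Set.mem_inter_iff, Set.mem_ofPred_eq, Set.mem_empty_iff_false, iff_false, not_and,
        Metric.mem_closedBall, dist_zero_right]
      intro h1 h2
      obtain ⟨i, hi⟩ := hq
      have hq0 : |q 0| = 1 := by
        rcases Fin.eq_zero_or_eq_succ i with h | ⟨j, h⟩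
        · rw [← h]; exact hi
        · exfalso
          have := abs_coord_le w j
          simp only [w] at this
          rw [h] at hi
          rw [hi] at this
          simp only [w] at hw
          linarith
      rw [hlin] at h1
      have h3 : |inner ℝ w x| ≤ ‖w‖ * ‖x‖ := abs_real_inner_le_norm w x
      have h4 : ‖w‖ * ‖x‖ ≤ 1 / 2 * 1 := mul_le_mul hw.le h2 (norm_nonneg _) (by norm_num)
      have h5 : |q 0| ≤ |q 0 + inner ℝ w x| + |inner ℝ w x| := by
        have := abs_sub (q 0 + inner ℝ w x) (inner ℝ w x)
        simpa using this
      linarith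
    rw [this]
    simp
    positivity
  push Not at hw
  have hw0 : 0 < ‖w‖ := by linarith
  set I : ℕ := ⌊1 / (6 * ω)⌋₊ with hI
  have hI1 : (1 : ℝ) / (6 * ω) ≤ 2 * I := by
    have h1 : (1 : ℝ) ≤ 1 / (6 * ω) := by rw [le_div_iff₀ (by positivity)]; linarith
    have h2 : (1 : ℕ) ≤ I := Nat.le_floor (by simpa using h1)
    have h3 : (1 : ℝ) ≤ I := by exact_mod_cast h2
    have := Nat.lt_floor_add_one ((1 : ℝ) / (6 * ω))
    linarith
  have hI2 : (I : ℝ) * (6 * ω) ≤ 1 := by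
    have := Nat.floor_le (show (0 : ℝ) ≤ 1 / (6 * ω) by positivity)
    rw [le_div_iff₀ (by positivity)] at this
    exact this
  let y : ℕ → Euc d := fun i => (i * (3 * ω / ‖w‖ ^ 2)) • w
  have hly : ∀ (i : ℕ) (x : Euc d), lin q (x - y i) = lin q x - 3 * ω * i := by
    intro i x
    rw [hlin, hlin, inner_sub_right, inner_smul_right, real_inner_self_eq_norm_sq]
    field_simp
    ring
  let T : ℕ → Set (Euc d) := fun i => (fun x => x + (-y i)) ⁻¹' S
  have hTv : ∀ i, volume.real (T i) = volume.real S := by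
    intro i
    simp only [T, Measure.real]
    congr 1
    exact measure_preimage_add_right volume (-y i) S
  have hdisj : Set.PairwiseDisjoint (↑(Finset.range I) : Set ℕ) T := by
    have key : ∀ i j : ℕ, i < j → Disjoint (T i) (T j) := by
      intro i j hij
      rw [Set.disjoint_left]
      intro x hx hx'
      have h1 : |lin q (x + (-y i))| ≤ ω := hx.1
      have h2 : |lin q (x + (-y j))| ≤ ω := hx'.1
      rw [← sub_eq_add_neg] at h1 h2
      rw [hly] at h1 h2
      have : (i : ℝ) + 1 ≤ j := by exact_mod_cast hij
      rw [abs_le] at h1 h2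
      nlinarith
    intro i _ j _ hij
    rcases lt_or_gt_of_ne hij with h | h
    · exact key i j h
    · exact (key j i h).symm
  have hsub : (⋃ i ∈ Finset.range I, T i) ⊆ Metric.closedBall 0 2 := by
    intro x hx
    simp only [Set.mem_iUnion] at hx
    obtain ⟨i, hi, hx⟩ := hx
    have h1 : ‖x - y i‖ ≤ 1 := by simpa [sub_eq_add_neg] using hx.2
    have h2 : ‖y i‖ ≤ 1 := by
      simp only [y, norm_smul, Real.norm_eq_abs]
      rw [abs_of_nonneg (by positivity)]
      have : (i : ℝ) ≤ I := by exact_mod_cast (Finset.mem_range.1 hi).le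
      have h3 : (i : ℝ) * (3 * ω / ‖w‖ ^ 2) * ‖w‖ = i * (3 * ω) / ‖w‖ := by field_simp
      rw [h3, div_le_iff₀ hw0]
      nlinarith
    have := norm_add_le (x - y i) (y i)
    simp only [sub_add_cancel] at this
    simp; linarith
  have hsum : volume.real (⋃ i ∈ Finset.range I, T i) = I * volume.real S := by
    rw [measureReal_biUnion_finset hdisj (fun i _ => hSm.preimage (by fun_prop)) (fun i hi => ?_)]
    · simp [hTv]
    · refine ((measure_mono ?_).trans_lt (isCompact_closedBall (0 : Euc d) 2).measure_lt_top).ne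
      exact (Set.subset_biUnion_of_mem (u := T) hi).trans hsub
  have hle : (I : ℝ) * volume.real S ≤ 2 ^ d * volume.real (Metric.closedBall (0 : Euc d) 1) := by
    rw [← hsum, ← volB_scale 2 (by norm_num) (0 : Euc d)]
    exact measureReal_mono hsub (isCompact_closedBall _ _).measure_lt_top.ne
  have hS0 : 0 ≤ volume.real S := measureReal_nonneg
  have h1 : 1 ≤ 12 * ω * I := by
    rw [div_le_iff₀ (by positivity)] at hI1
    linarith
  calc volume.real S ≤ (12 * ω * I) * volume.real S := by nlinarith
    _ = 12 * ω * (I * volume.real S) := by ring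
    _ ≤ 12 * ω * (2 ^ d * volume.real (Metric.closedBall (0 : Euc d) 1)) := by gcongr
    _ = _ := by ring

lemma unif_cap {d : ℕ} (u : Euc d) (hu : ‖u‖ = 1) (h : ℝ) (h0 : 0 < h) (h1 : h ≤ 1) :
    (√h / 2) ^ (d + 1) ≤ (uniformBall d).real {x | 1 - h < ∑ j, u j * x j} := by
  set a : ℝ := √h / 2 with ha
  have hsq : √h ^ 2 = h := Real.sq_sqrt h0.le
  have hs1 : √h ≤ 1 := Real.sqrt_le_one.2 h1
  have ha0 : 0 < a := by positivity
  have ha1 : a ≤ 1 := by rw [ha]; linarith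
  set b : ℝ := h / 4 with hb
  let Mx : Matrix (Fin d) (Fin d) ℝ := a • (1 + Matrix.replicateCol Unit (fun j => ((b - a) / a) * u j) * Matrix.replicateRow Unit (fun j => u j))
  have hus : ∑ j, u j * u j = 1 := by
    have := EuclideanSpace.real_norm_sq_eq u
    rw [hu] at this
    rw [← one_pow 2, this]
    simp [pow_two]
  have hdet : Mx.det = a ^ d * (b / a) := by
    simp only [Mx, Matrix.det_smul, Fintype.card_fin]
    rw [Matrix.det_one_add_replicateCol_mul_replicateRow]
    congr 1
    simp only [dotProduct]
    have : ∑ j, u j * ((b - a) / a * u j) = (b - a) / a := by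
      calc _ = (b - a) / a * ∑ j, u j * u j := by rw [Finset.mul_sum]; congr 1; ext j; ring
        _ = _ := by rw [hus, mul_one]
    rw [this]; field_simp; ring
  let Φ : Euc d →ₗ[ℝ] Euc d := Matrix.toEuclideanLin Mx
  have hΦdet : LinearMap.det Φ = a ^ d * (b / a) := by
    rw [← hdet]
    simp only [Φ]
    rw [Matrix.toEuclideanLin_eq_toLin_orthonormal, LinearMap.det_toLin]
  have hΦ : ∀ x, Φ x = a • x + ((b - a) * inner ℝ u x) • u := by
    intro x
    ext i
    simp only [Φ, Mx, Matrix.toLpLin_apply, Matrix.smul_mulVec, Matrix.add_mulVec, Matrix.one_mulVec]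
    have hin : inner ℝ u x = ∑ j, u j * x j := by simp [PiLp.inner_apply, mul_comm]
    rw [hin]
    simp [Matrix.mulVec, dotProduct, Matrix.mul_apply]
    have : ∑ j, (b - a) / a * u i * u j * x j = (b - a) / a * u i * ∑ j, u j * x j := by
      rw [Finset.mul_sum]; congr 1; ext j; ring
    rw [this]; field_simp
  set c : Euc d := (1 - h / 2) • u with hc
  have hin : ∀ x : Euc d, ∑ j, u j * x j = inner ℝ u x := by
    intro x; simp [PiLp.inner_apply, mul_comm]
  have hmeas : MeasurableSet {x : Euc d | 1 - h < ∑ j, u j * x j} := by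
    apply measurableSet_lt measurable_const
    fun_prop
  rw [uniformBall_real _ hmeas, le_div_iff₀ (volB_pos d)]
  have huu : inner ℝ u u = (1 : ℝ) := by rw [real_inner_self_eq_norm_sq, hu]; norm_num
  have hsub : (fun x => c + x) '' (Φ '' Metric.closedBall 0 1) ⊆ {x : Euc d | 1 - h < ∑ j, u j * x j} ∩ Metric.closedBall 0 1 := by
    rintro _ ⟨_, ⟨x, hx, rfl⟩, rfl⟩
    have hx1 : ‖x‖ ≤ 1 := by simpa using hx
    set s : ℝ := inner ℝ u x with hs
    have hsx : |s| ≤ 1 := by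
      have := abs_real_inner_le_norm u x
      rw [hu, one_mul] at this
      exact this.trans hx1
    rw [abs_le] at hsx
    have hiu : inner ℝ u (c + Φ x) = 1 - h / 2 + b * s := by
      rw [hΦ, hc, inner_add_right, inner_add_right, inner_smul_right, inner_smul_right, inner_smul_right, huu, ← hs]
      ring
    have hnorm : ‖c + Φ x‖ ^ 2 ≤ 1 := by
      have e : c + Φ x = (1 - h / 2 + (b - a) * s) • u + a • x := by
        rw [hΦ, hc]; module
      rw [e, norm_add_sq_real, inner_smul_left, inner_smul_right, norm_smul, norm_smul, hu, ← hs]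
      simp only [Real.norm_eq_abs, mul_pow, sq_abs, conj_trivial, mul_one, one_pow]
      have hx2 : ‖x‖ ^ 2 ≤ 1 := by nlinarith [norm_nonneg x]
      have ha2 : a ^ 2 = h / 4 := by rw [ha, div_pow, hsq]; norm_num
      have : (1 - h / 2 + (b - a) * s) ^ 2 + 2 * ((1 - h / 2 + (b - a) * s) * (a * s)) + a ^ 2 * ‖x‖ ^ 2 =
        (1 - h / 2 + b * s) ^ 2 + a ^ 2 * (‖x‖ ^ 2 - s ^ 2) := by ring
      rw [this, ha2]
      have h3 : 0 ≤ 1 - h / 2 + b * s := by rw [hb]; nlinarith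
      have h4 : 1 - h / 2 + b * s ≤ 1 - h / 4 := by rw [hb]; nlinarith
      have h5 : (1 - h / 2 + b * s) ^ 2 ≤ (1 - h / 4) ^ 2 := by gcongr
      nlinarith [sq_nonneg s]
    refine ⟨?_, ?_⟩
    · show 1 - h < _
      rw [hin, hiu, hb]; nlinarith
    · simp only [Metric.mem_closedBall, dist_zero_right]
      nlinarith [norm_nonneg (c + Φ x)]
  have hvol : volume.real ((fun x => c + x) '' (Φ '' Metric.closedBall 0 1)) = a ^ d * (b / a) * volume.real (Metric.closedBall (0 : Euc d) 1) := by
    simp only [Measure.real]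
    rw [Set.image_add_left, measure_preimage_add, Measure.addHaar_image_linearMap, hΦdet, ENNReal.toReal_mul,
      ENNReal.toReal_ofReal (abs_nonneg _), abs_of_nonneg (by positivity)]
  have hba : b / a = a := by
    rw [div_eq_iff ha0.ne', hb, ← hsq, ha]; ring
  calc a ^ (d + 1) * volume.real (Metric.closedBall (0 : Euc d) 1) = a ^ d * (b / a) * volume.real (Metric.closedBall (0 : Euc d) 1) := by
        rw [hba, pow_succ]
    _ ≤ _ := by
      rw [← hvol]
      refine measureReal_mono hsub ?_
      exact ((measure_mono Set.inter_subset_right).trans_lt (isCompact_closedBall (0 : Euc d) 1).measure_lt_top).ne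

/-- empirical average -/
def avg {E : Type*} {n : ℕ} (ω : Fin n → E) (h : E → ℝ) : ℝ := (1 / (n : ℝ)) * ∑ i, h (ω i)

lemma hoeff {E : Type*} [MeasurableSpace E] (P : Measure E) [IsProbabilityMeasure P] {n : ℕ} (hn : 0 < n)
    (h : E → ℝ) (hm : Measurable h) (B : ℝ) (hB : 0 < B) (hb : ∀ᵐ z ∂P, h z ∈ Set.Icc 0 B)
    (s : ℝ) (hs : 0 ≤ s) :
    (Measure.pi fun _ : Fin n => P).real {ω | B * s ≤ avg ω h - ∫ z, h z ∂P} ≤ exp (-2 * n * s ^ 2) := by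
  set μ := Measure.pi fun _ : Fin n => P
  have hn' : (0 : ℝ) < n := by exact_mod_cast hn
  have hmp : ∀ i, MeasurePreserving (fun ω : Fin n → E => ω i) μ P := fun i =>
    measurePreserving_eval (fun _ : Fin n => P) i
  have hint : ∀ i, ∫ ω, h (ω i) ∂μ = ∫ z, h z ∂P := fun i => by
    rw [← (hmp i).map_eq, integral_map (hmp i).measurable.aemeasurable hm.aestronglyMeasurable]
  have hind : iIndepFun (fun (i : Fin n) (ω : Fin n → E) => h (ω i) - ∫ z, h z ∂P) μ :=
    iIndepFun_pi (X := fun _ z => h z - ∫ z, h z ∂P) (fun i => (hm.sub_const _).aemeasurable)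
  have hsub : ∀ i ∈ (Finset.univ : Finset (Fin n)), HasSubgaussianMGF (fun ω : Fin n → E => h (ω i) - ∫ z, h z ∂P) ((‖B - 0‖₊ / 2) ^ 2) μ := by
    intro i _
    have := hasSubgaussianMGF_of_mem_Icc (μ := μ) (X := fun ω => h (ω i)) (a := 0) (b := B)
      (hm.comp (measurable_pi_apply i)).aemeasurable ((hmp i).quasiMeasurePreserving.ae hb)
    rwa [hint i] at this
  have key := HasSubgaussianMGF.measure_sum_ge_le_of_iIndepFun hind hsub (ε := n * (B * s)) (by positivity)
  have e1 : {ω : Fin n → E | B * s ≤ avg ω h - ∫ z, h z ∂P} = {ω | n * (B * s) ≤ ∑ i, (h (ω i) - ∫ z, h z ∂P)} := by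
    ext ω
    simp only [Set.mem_ofPred_eq, avg, Finset.sum_sub_distrib, Finset.sum_const, Finset.card_univ, Fintype.card_fin, nsmul_eq_mul]
    rw [show (1 / (n : ℝ) * ∑ i, h (ω i) - ∫ z, h z ∂P) = (∑ i, h (ω i) - n * ∫ z, h z ∂P) / n by field_simp,
      le_div_iff₀ hn', mul_comm]
  rw [e1]
  refine key.trans (exp_le_exp.2 (le_of_eq ?_))
  simp only [Finset.sum_const, Finset.card_univ, Fintype.card_fin, nsmul_eq_mul, sub_zero]
  push_cast
  rw [Real.norm_of_nonneg hB.le]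
  field_simp

lemma hoeff_lower {E : Type*} [MeasurableSpace E] (P : Measure E) [IsProbabilityMeasure P] {n : ℕ} (hn : 0 < n)
    (h : E → ℝ) (hm : Measurable h) (B : ℝ) (hB : 0 < B) (hb : ∀ᵐ z ∂P, h z ∈ Set.Icc 0 B)
    (s : ℝ) (hs : 0 ≤ s) :
    (Measure.pi fun _ : Fin n => P).real {ω | B * s ≤ (∫ z, h z ∂P) - avg ω h} ≤ exp (-2 * n * s ^ 2) := by
  have hn' : (0 : ℝ) < n := by exact_mod_cast hn
  have hi : Integrable h P := Integrable.of_mem_Icc 0 B hm.aemeasurable hb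
  have := hoeff P hn (fun z => B - h z) (measurable_const.sub hm) B hB
    (by filter_upwards [hb] with z hz; constructor <;> linarith [hz.1, hz.2]) s hs
  convert this using 4 with ω
  rw [integral_sub (integrable_const _) hi]
  simp [avg, Finset.sum_sub_distrib]
  field_simp
  ring_nf

lemma chern {E : Type*} [MeasurableSpace E] (P : Measure E) [IsProbabilityMeasure P] {n : ℕ} (hn : 0 < n)
    (S : Set E) (hS : MeasurableSet S) (p s : ℝ) (hp : P.real S ≤ p) :
    (Measure.pi fun _ : Fin n => P).real {ω | 2 * p + s / n ≤ avg ω (S.indicator fun _ => (1 : ℝ))} ≤ exp (-s) := by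
  set μ := Measure.pi fun _ : Fin n => P
  have hn' : (0 : ℝ) < n := by exact_mod_cast hn
  have hp0 : 0 ≤ p := measureReal_nonneg.trans hp
  set F : E → ℝ := fun z => exp (S.indicator (fun _ => (1 : ℝ)) z) with hF
  have hFm : Measurable F := (measurable_const.indicator hS).exp
  have hFe : F = fun z => 1 + S.indicator (fun _ => (exp 1 - 1 : ℝ)) z := by
    ext z; simp only [hF, Set.indicator]; split_ifs <;> simp
  have hFi : ∫ z, F z ∂P ≤ exp (2 * p) := by
    rw [hFe, integral_add (integrable_const _) ((integrable_const _).indicator hS), integral_indicator_const _ hS]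
    simp only [integral_const, probReal_univ, smul_eq_mul, one_mul]
    have : exp 1 < 2.7182818286 := exp_one_lt_d9
    have h2 := add_one_le_exp (2 * p)
    have h3 : 0 ≤ P.real S := measureReal_nonneg
    have h4 : 1 ≤ exp 1 := one_le_exp (by norm_num)
    nlinarith
  have hprod : ∫ ω : Fin n → E, ∏ i, F (ω i) ∂μ ≤ exp (2 * p * n) := by
    rw [integral_fintype_prod_eq_pow, Fintype.card_fin]
    calc _ ≤ (exp (2 * p)) ^ n := by
          gcongr
      _ = _ := by rw [← exp_nat_mul]; congr 1; ring
  have hFb : ∀ z, F z ≤ exp 1 := fun z => exp_le_exp.2 (by simp only [Set.indicator]; split_ifs <;> simp)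
  have hFint : Integrable (fun ω : Fin n → E => ∏ i, F (ω i)) μ := by
    refine Integrable.of_bound (C := exp 1 ^ n) (Finset.measurable_prod _ fun i _ => hFm.comp (measurable_pi_apply i)).aestronglyMeasurable ?_
    refine ae_of_all _ fun ω => ?_
    rw [Real.norm_of_nonneg (Finset.prod_nonneg fun i _ => (exp_pos _).le)]
    calc ∏ i, F (ω i) ≤ ∏ i : Fin n, exp 1 := Finset.prod_le_prod (fun i _ => (exp_pos _).le) (fun i _ => hFb _)
      _ = _ := by simp
  have mk := mul_meas_ge_le_integral_of_nonneg (μ := μ) (f := fun ω : Fin n → E => ∏ i, F (ω i)) (ae_of_all _ fun ω => Finset.prod_nonneg fun i _ => (exp_pos _).le) hFint (exp (2 * p * n + s))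
  have hset : {ω : Fin n → E | 2 * p + s / n ≤ avg ω (S.indicator fun _ => (1 : ℝ))} ⊆ {ω | exp (2 * p * n + s) ≤ ∏ i, F (ω i)} := by
    intro ω hω
    simp only [Set.mem_ofPred_eq, avg] at hω ⊢
    rw [hF, ← exp_sum, exp_le_exp]
    have := mul_le_mul_of_nonneg_left hω hn'.le
    field_simp at this
    linarith
  have h5 := measureReal_mono hset (measure_ne_top μ _)
  have h6 : exp (2 * p * n + s) * μ.real {ω | 2 * p + s / n ≤ avg ω (S.indicator fun _ => (1 : ℝ))} ≤ exp (2 * p * n) :=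
    (mul_le_mul_of_nonneg_left h5 (exp_pos _).le).trans (mk.trans hprod)
  rw [exp_add, mul_assoc] at h6
  have h7 := (mul_le_iff_le_one_right (exp_pos (2 * p * n))).1 h6
  rw [exp_neg]
  rw [← one_div, le_div_iff₀ (exp_pos s), mul_comm]
  exact h7

lemma maurey {X : Type*} [MeasurableSpace X] (Q : Measure X) [IsFiniteMeasure Q] {ι : Type*} [Fintype ι]
    (lam : ι → ℝ) (hl : ∀ i, 0 ≤ lam i) (hl1 : ∑ i, lam i = 1) (u : ι → X → ℝ)
    (hu : ∀ i, MemLp (u i) 2 Q) (ρ : ℝ) (hρ : ∀ i, ∫ x, u i x ^ 2 ∂Q ≤ ρ) (N : ℕ) :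
    ∃ idx : Fin N → ι, ∫ x, (∑ l, u (idx l) x - N * ∑ i, lam i * u i x) ^ 2 ∂Q ≤ N * ρ := by
  have hv : MemLp (fun x => ∑ i, lam i * u i x) 2 Q :=
    memLp_finsetSum (p := 2) (μ := Q) Finset.univ (fun i _ => (hu i).const_mul (lam i))
  induction N with
  | zero => exact ⟨Fin.elim0, by simp⟩
  | succ N ih =>
    obtain ⟨idx, hidx⟩ := ih
    set v : X → ℝ := fun x => ∑ i, lam i * u i x with hvdef
    set S : X → ℝ := fun x => ∑ l, u (idx l) x - N * v x with hS
    have hSm : MemLp S 2 Q :=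
      (memLp_finsetSum (p := 2) (μ := Q) Finset.univ (fun l _ => hu (idx l))).sub (hv.const_mul (N : ℝ))
    have hTm : ∀ i, MemLp (fun x => S x + u i x - v x) 2 Q := fun i => (hSm.add (hu i)).sub hv
    have hstep : ∃ i, ∫ x, (S x + u i x - v x) ^ 2 ∂Q ≤ ∫ x, S x ^ 2 ∂Q + ρ := by
      by_contra hcon
      push Not at hcon
      have h1 : ∑ i, lam i * ∫ x, (S x + u i x - v x) ^ 2 ∂Q = ∫ x, ∑ i, lam i * (S x + u i x - v x) ^ 2 ∂Q := by
        rw [integral_finsetSum _ (fun i _ => (hTm i).integrable_sq.const_mul _)]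
        simp_rw [integral_const_mul]
      have h2 : ∀ x, ∑ i, lam i * (S x + u i x - v x) ^ 2 = S x ^ 2 + ∑ i, lam i * u i x ^ 2 - v x ^ 2 := by
        intro x
        have : ∀ i, lam i * (S x + u i x - v x) ^ 2 = lam i * (S x - v x) ^ 2 + 2 * (S x - v x) * (lam i * u i x) + lam i * u i x ^ 2 := fun i => by ring
        simp_rw [this, Finset.sum_add_distrib, ← Finset.sum_mul, ← Finset.mul_sum, hl1]
        rw [show ∑ i, lam i * u i x = v x from rfl]
        ring
      have h3 : ∫ x, ∑ i, lam i * (S x + u i x - v x) ^ 2 ∂Q ≤ ∫ x, S x ^ 2 ∂Q + ρ := by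
        simp_rw [h2]
        have hi2 : Integrable (fun x => ∑ i, lam i * u i x ^ 2) Q :=
          integrable_finsetSum _ (fun i _ => (hu i).integrable_sq.const_mul _)
        have hi3 : Integrable (fun x => S x ^ 2 + ∑ i, lam i * u i x ^ 2) Q := hSm.integrable_sq.add hi2
        rw [integral_sub hi3 hv.integrable_sq, integral_add hSm.integrable_sq hi2,
          integral_finsetSum _ (fun i _ => (hu i).integrable_sq.const_mul _)]
        simp_rw [integral_const_mul]
        have h4 : ∑ i, lam i * ∫ x, u i x ^ 2 ∂Q ≤ ∑ i, lam i * ρ :=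
          Finset.sum_le_sum fun i _ => mul_le_mul_of_nonneg_left (hρ i) (hl i)
        rw [← Finset.sum_mul, hl1, one_mul] at h4
        have h5 : 0 ≤ ∫ x, v x ^ 2 ∂Q := integral_nonneg fun x => sq_nonneg _
        linarith
      rw [← h1] at h3
      have hex : ∃ i, 0 < lam i := by
        by_contra h; push Not at h
        have : ∑ i, lam i ≤ 0 := Finset.sum_nonpos fun i _ => h i
        linarith
      obtain ⟨i0, hi0⟩ := hex
      have h6 : ∑ i, lam i * (∫ x, S x ^ 2 ∂Q + ρ) < ∑ i, lam i * ∫ x, (S x + u i x - v x) ^ 2 ∂Q :=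
        Finset.sum_lt_sum (fun i _ => mul_le_mul_of_nonneg_left (hcon i).le (hl i))
          ⟨i0, Finset.mem_univ _, mul_lt_mul_of_pos_left (hcon i0) hi0⟩
      rw [← Finset.sum_mul, hl1, one_mul] at h6
      linarith
    obtain ⟨i, hi⟩ := hstep
    refine ⟨Fin.cons i idx, ?_⟩
    have e : ∀ x, ∑ l, u ((Fin.cons i idx : Fin (N + 1) → ι) l) x - ((N + 1 : ℕ) : ℝ) * v x = S x + u i x - v x := by
      intro x
      rw [Fin.sum_univ_succ]
      simp [hS]; ring
    have e2 : ∫ x, (∑ l, u ((Fin.cons i idx : Fin (N + 1) → ι) l) x - ((N + 1 : ℕ) : ℝ) * v x) ^ 2 ∂Q = ∫ x, (S x + u i x - v x) ^ 2 ∂Q := by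
      simp_rw [e]
    refine (le_of_eq e2).trans ?_
    push_cast
    linarith

/-- rounding -/
def zr {d : ℕ} (m : ℕ) (p : Fin (d + 1) → ℝ) : Fin (d + 1) → ℤ := fun j => round (m * p j)

def qz {d : ℕ} (m : ℕ) (z : Fin (d + 1) → ℤ) : Fin (d + 1) → ℝ := fun j => (z j : ℝ) / m

def Zf (d m : ℕ) : Finset (Fin (d + 1) → ℤ) :=
  Finset.univ.biUnion fun i : Fin (d + 1) =>
    Fintype.piFinset fun j => if j = i then {-(m : ℤ), (m : ℤ)} else Finset.Icc (-(m : ℤ)) m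

lemma Zf_card (d m : ℕ) : (Zf d m).card ≤ (d + 1) * (2 * (2 * m + 1) ^ d) := by
  refine Finset.card_biUnion_le.trans ?_
  calc _ ≤ ∑ i : Fin (d + 1), 2 * (2 * m + 1) ^ d := by
        refine Finset.sum_le_sum fun i _ => ?_
        rw [Fintype.card_piFinset, ← Finset.mul_prod_erase Finset.univ _ (Finset.mem_univ i)]
        refine Nat.mul_le_mul ?_ ?_
        · simp only [if_true]; exact Finset.card_le_two
        · refine (Finset.prod_le_pow_card _ _ (2 * m + 1) ?_).trans ?_
          · intro j hj
            rw [if_neg (Finset.ne_of_mem_erase hj)]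
            simp; omega
          · simp
    _ = _ := by simp

lemma Zf_mem {d : ℕ} (m : ℕ) (p : Fin (d + 1) → ℝ) (hp : ∀ j, |p j| ≤ 1) (hp1 : ∃ j, |p j| = 1) : zr m p ∈ Zf d m := by
  obtain ⟨i, hi⟩ := hp1
  simp only [Zf, Finset.mem_biUnion, Finset.mem_univ, true_and, Fintype.mem_piFinset]
  refine ⟨i, fun j => ?_⟩
  split_ifs with hj
  · subst hj
    simp only [zr, Finset.mem_insert, Finset.mem_singleton]
    rcases abs_eq (zero_le_one) |>.1 hi with h | h
    · right; rw [h]; simp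
    · left; rw [h, show (m : ℝ) * -1 = ((-(m : ℤ) : ℤ) : ℝ) by push_cast; ring, round_intCast]
  · have := abs_le.1 (hp j)
    have hm : (0 : ℝ) ≤ m := Nat.cast_nonneg m
    have h1 : round (-(m : ℝ)) ≤ round (m * p j) := by
      rw [round_eq, round_eq]; apply Int.floor_mono; nlinarith
    have h2 : round (m * p j) ≤ round (m : ℝ) := by
      rw [round_eq, round_eq]; apply Int.floor_mono; nlinarith
    rw [show (-(m : ℝ)) = ((-(m : ℤ) : ℤ) : ℝ) by push_cast; ring, round_intCast] at h1
    rw [round_natCast] at h2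
    simp only [zr, Finset.mem_Icc]
    exact ⟨h1, h2⟩

lemma Zf_one {d : ℕ} (m : ℕ) (hm : 0 < m) (z : Fin (d + 1) → ℤ) (hz : z ∈ Zf d m) : ∃ j, |qz m z j| = 1 := by
  simp only [Zf, Finset.mem_biUnion, Finset.mem_univ, true_and, Fintype.mem_piFinset] at hz
  obtain ⟨i, hi⟩ := hz
  have := hi i
  have hm' : (m : ℝ) ≠ 0 := by positivity
  simp only [if_true, Finset.mem_insert, Finset.mem_singleton] at this
  refine ⟨i, ?_⟩
  rcases this with h | h <;> simp [qz, h, hm']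

lemma zr_close {d : ℕ} (m : ℕ) (hm : 0 < m) (p : Fin (d + 1) → ℝ) (j) : |p j - qz m (zr m p) j| ≤ 1 / m := by
  have hm' : (0 : ℝ) < m := by positivity
  have := abs_sub_round (m * p j)
  rw [show p j - qz m (zr m p) j = (m * p j - round (m * p j)) / m by simp [qz, zr]; field_simp, abs_div, abs_of_pos hm']
  gcongr; linarith

lemma lin_bound {d : ℕ} (p : Fin (d + 1) → ℝ) (b : ℝ) (hp : ∀ j, |p j| ≤ b) (x : Euc d) (hx : ‖x‖ ≤ 1) :
    |lin p x| ≤ (d + 1) * b := by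
  have hb : 0 ≤ b := (abs_nonneg _).trans (hp 0)
  have h : |∑ j : Fin d, p j.succ * x j| ≤ ∑ j : Fin d, b := by
    refine (Finset.abs_sum_le_sum_abs _ _).trans (Finset.sum_le_sum fun j _ => ?_)
    rw [abs_mul]
    calc _ ≤ b * 1 := mul_le_mul (hp _) ((abs_coord_le x j).trans hx) (abs_nonneg _) hb
      _ = b := mul_one b
  simp at h
  have h2 := abs_add_le (p 0) (∑ j : Fin d, p j.succ * x j)
  have h3 := hp 0
  unfold lin
  linarith

lemma lin_sub {d : ℕ} (p q : Fin (d + 1) → ℝ) (x : Euc d) : lin p x - lin q x = lin (fun j => p j - q j) x := by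
  simp only [lin, sub_mul, Finset.sum_sub_distrib]; ring

lemma lin_add {d : ℕ} (p q : Fin (d + 1) → ℝ) (x : Euc d) : lin (fun j => p j + q j) x = lin p x + lin q x := by
  simp only [lin, add_mul, Finset.sum_add_distrib]; ring

lemma lin_smul {d : ℕ} (a : ℝ) (p : Fin (d + 1) → ℝ) (x : Euc d) : lin (fun j => a * p j) x = a * lin p x := by
  simp only [lin, mul_add, Finset.mul_sum, mul_assoc]

lemma lin_sum {d : ℕ} {ι : Type*} (s : Finset ι) (p : ι → Fin (d + 1) → ℝ) (x : Euc d) :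
    lin (fun j => ∑ i ∈ s, p i j) x = ∑ i ∈ s, lin (p i) x := by
  simp only [lin, Finset.sum_mul, Finset.sum_add_distrib]
  rw [Finset.sum_comm]

/-- residual of a neuron -/
def resid {d : ℕ} (m : ℕ) (p : Fin (d + 1) → ℝ) (x : Euc d) : ℝ :=
  relu (lin p x) - if 0 < lin (qz m (zr m p)) x then lin p x else 0

lemma relu_measurable : Measurable relu := by unfold relu; fun_prop

lemma resid_measurable {d : ℕ} (m : ℕ) (p : Fin (d + 1) → ℝ) : Measurable (resid m p : Euc d → ℝ) := by
  refine (relu_measurable.comp (lin_continuous p).measurable).sub ?_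
  exact Measurable.ite (measurableSet_lt measurable_const (lin_continuous _).measurable) (lin_continuous p).measurable measurable_const

lemma resid_sq {d : ℕ} (m : ℕ) (hm : 0 < m) (p : Fin (d + 1) → ℝ) (x : Euc d) (hx : ‖x‖ ≤ 1) :
    resid m p x ^ 2 ≤ {x : Euc d | |lin (qz m (zr m p)) x| ≤ (d + 1) / m}.indicator (fun _ => (((d : ℝ) + 1) / m) ^ 2) x := by
  have h := lin_bound _ (1 / m) (zr_close m hm p) x hx
  rw [← lin_sub, mul_one_div] at h
  have hω : (0 : ℝ) ≤ (d + 1) / m := by positivity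
  set ω : ℝ := (d + 1) / m
  set A := lin p x with hA0
  set B := lin (qz m (zr m p)) x with hB
  rw [abs_le] at h
  simp only [resid, Set.indicator, Set.mem_ofPred_eq, relu]
  rw [← hB, ← hA0]
  rcases le_or_gt A 0 with hA | hA
  · rw [max_eq_right hA]
    split_ifs with h1 h2 h2
    · nlinarith
    · exact absurd (abs_le.2 ⟨by linarith, by linarith⟩) h2
    · simp; positivity
    · simp
  · rw [max_eq_left hA.le]
    split_ifs with h1 h2 h2
    · simp; positivity
    · simp
    · nlinarith
    · exact absurd (abs_le.2 ⟨by linarith, by linarith⟩) h2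

abbrev JJ (d m N : ℕ) : Type := {z : Fin (d + 1) → ℤ // z ∈ Zf d m} ⊕ ((Fin N × Bool) ⊕ Unit)

def indz {d : ℕ} (m : ℕ) (z : Fin (d + 1) → ℤ) (x : Euc d) : ℝ := if 0 < lin (qz m z) x then 1 else 0

def phi {d m N : ℕ} (j : JJ d m N) (t : ℝ) (x : Euc d) : ℝ :=
  match j with
  | Sum.inl z => t * indz m z.1 x
  | Sum.inr (Sum.inl (_, true)) => relu t
  | Sum.inr (Sum.inl (_, false)) => - relu t
  | Sum.inr (Sum.inr _) => t

def gfun {d m N : ℕ} (c : JJ d m N → Fin (d + 1) → ℝ) (x : Euc d) : ℝ := ∑ j, phi j (lin (c j) x) x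

def sg (a : ℝ) : ℝ := if 0 ≤ a then 1 else -1

lemma abs_mul_sg (a : ℝ) : |a| * sg a = a := by
  unfold sg; split_ifs with h
  · rw [abs_of_nonneg h, mul_one]
  · rw [abs_of_neg (not_le.1 h)]; ring

lemma abs_sg (a : ℝ) : |sg a| = 1 := by unfold sg; split_ifs <;> simp

lemma relu_mul (a t : ℝ) (ha : 0 ≤ a) : relu (a * t) = a * relu t := by
  unfold relu; rw [mul_max_of_nonneg _ _ ha, mul_zero]

lemma lin_zero {d : ℕ} (x : Euc d) : lin (fun _ => 0) x = 0 := by simp [lin]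

lemma approx {d m N : ℕ} (hm : 0 < m) (hN : 0 < N) (Q : Measure (Euc d)) [IsFiniteMeasure Q]
    (hQ : ∀ᵐ x ∂Q, ‖x‖ ≤ 1) (σ : ℝ)
    (hσ : ∀ z ∈ Zf d m, Q.real {x | |lin (qz m z) x| ≤ (d + 1) / m} ≤ σ)
    {κ : Type*} [Fintype κ] (α : κ → ℝ) (p : κ → Fin (d + 1) → ℝ) (hp : ∀ k j, |p k j| ≤ 1)
    (hp1 : ∀ k, ∃ j, |p k j| = 1) (β C : ℝ) (hC : 0 < C) (hα : ∑ k, |α k| ≤ C) :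
    ∃ c : JJ d m N → Fin (d + 1) → ℝ, (∀ j i, |c j i| ≤ |β| + 2 * C) ∧
      ∫ x, (∑ k, α k * relu (lin (p k) x) + β - gfun c x) ^ 2 ∂Q ≤ C ^ 2 * ((d + 1) / m) ^ 2 * σ / N := by
  set om : ℝ := ((d : ℝ) + 1) / m with hom
  have hom0 : 0 ≤ om := by positivity
  have hN' : (0 : ℝ) < N := by exact_mod_cast hN
  have hN1 : (1 : ℝ) ≤ N := by exact_mod_cast hN
  let lam : Option κ → ℝ := fun o => match o with
    | none => 1 - (∑ k, |α k|) / C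
    | some k => |α k| / C
  let u : Option κ → Euc d → ℝ := fun o => match o with
    | none => fun _ => 0
    | some k => fun x => C * sg (α k) * resid m (p k) x
  have hρ : ∀ o, ∫ x, u o x ^ 2 ∂Q ≤ C ^ 2 * om ^ 2 * σ := by
    have hσ0 : ∀ k : κ, Q.real {x | |lin (qz m (zr m (p k))) x| ≤ (d + 1) / m} ≤ σ := fun k => hσ _ (Zf_mem m (p k) (hp k) (hp1 k))
    rintro (_ | k)
    · simp only [u]
      have : 0 ≤ σ := by
        have hz : zr m (fun _ => (1 : ℝ)) ∈ Zf d m := Zf_mem m _ (fun j => by simp) ⟨0, by simp⟩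
        exact measureReal_nonneg.trans (hσ _ hz)
      simp; positivity
    · simp only [u, mul_pow]
      have e : sg (α k) ^ 2 = 1 := by rw [← sq_abs, abs_sg]; norm_num
      rw [e, mul_one, integral_const_mul, mul_assoc]
      gcongr
      have hms : MeasurableSet {x : Euc d | |lin (qz m (zr m (p k))) x| ≤ (d + 1) / m} :=
        measurableSet_le (lin_continuous _).measurable.abs measurable_const
      calc ∫ x, resid m (p k) x ^ 2 ∂Q ≤ ∫ x, {x : Euc d | |lin (qz m (zr m (p k))) x| ≤ (d + 1) / m}.indicator (fun _ => om ^ 2) x ∂Q := by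
            refine integral_mono_of_nonneg (ae_of_all _ fun x => sq_nonneg _) ((integrable_const _).indicator hms) ?_
            filter_upwards [hQ] with x hx
            exact resid_sq m hm (p k) x hx
        _ = Q.real {x : Euc d | |lin (qz m (zr m (p k))) x| ≤ (d + 1) / m} * om ^ 2 := by
            rw [integral_indicator_const _ hms, smul_eq_mul]
        _ ≤ _ := by rw [mul_comm]; gcongr; exact hσ0 k
  have hum : ∀ o, MemLp (u o) 2 Q := by
    rintro (_ | k)
    · exact MemLp.zero'
    · refine MemLp.const_mul (MemLp.of_bound (resid_measurable m (p k)).aestronglyMeasurable om ?_) _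
      filter_upwards [hQ] with x hx
      have := resid_sq m hm (p k) x hx
      rw [Real.norm_eq_abs]
      refine abs_le_of_sq_le_sq (this.trans ?_) hom0
      simp only [Set.indicator]; split_ifs
      · exact le_rfl
      · positivity
  have hlam : ∀ o, 0 ≤ lam o := by
    rintro (_ | k)
    · simp only [lam, sub_nonneg]; rw [div_le_one hC]; exact hα
    · simp only [lam]; positivity
  have hlam1 : ∑ o, lam o = 1 := by
    rw [Fintype.sum_option]; simp only [lam]; rw [← Finset.sum_div]; ring
  obtain ⟨idx, hidx⟩ := maurey Q lam hlam hlam1 u hum _ hρ N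
  have hv : ∀ x, ∑ o, lam o * u o x = ∑ k, α k * resid m (p k) x := by
    intro x
    rw [Fintype.sum_option]; simp only [lam, u, mul_zero, zero_add]
    refine Finset.sum_congr rfl fun k _ => ?_
    calc |α k| / C * (C * sg (α k) * resid m (p k) x) = (|α k| * sg (α k)) * resid m (p k) x := by field_simp
      _ = _ := by rw [abs_mul_sg]
  let zk : κ → {z : Fin (d + 1) → ℤ // z ∈ Zf d m} := fun k => ⟨zr m (p k), Zf_mem m (p k) (hp k) (hp1 k)⟩
  let cl : κ → ℝ → {z : Fin (d + 1) → ℤ // z ∈ Zf d m} → Fin (d + 1) → ℝ := fun k a z i => if zk k = z then a * p k i else 0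
  let cn : Option κ → {z : Fin (d + 1) → ℤ // z ∈ Zf d m} → Fin (d + 1) → ℝ := fun o => match o with
    | none => fun _ _ => 0
    | some k => cl k (C / N * sg (α k))
  let pc : Option κ → Bool → Fin (d + 1) → ℝ := fun o b => match o with
    | none => fun _ => 0
    | some k => fun i => if decide (0 ≤ α k) = b then C / N * p k i else 0
  have hcl : ∀ k a x, ∑ z, lin (cl k a z) x * indz m z.1 x = a * (lin (p k) x * indz m (zr m (p k)) x) := by
    intro k a x
    rw [Finset.sum_eq_single (zk k)]
    · simp only [cl, if_true, lin_smul, zk]; ring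
    · intro z _ hz
      have : ¬ zk k = z := fun h => hz h.symm
      simp only [cl, this, if_false, lin_zero, zero_mul]
    · simp
  have hrs : ∀ k x, resid m (p k) x = relu (lin (p k) x) - lin (p k) x * indz m (zr m (p k)) x := by
    intro k x; simp only [resid, indz]; split_ifs <;> simp
  have hcn : ∀ (o : Option κ) x, relu (lin (pc o true) x) - relu (lin (pc o false) x) - ∑ z, lin (cn o z) x * indz m z.1 x = (1 / N) * u o x := by
    rintro (_ | k) x
    · simp [pc, cn, u, lin_zero]
    · simp only [cn, hcl, u, hrs, pc, sg]
      have hCN : 0 ≤ C / N := by positivity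
      by_cases h : 0 ≤ α k
      · simp only [h, decide_true, if_true, lin_smul, lin_zero, reduceCtorEq, if_false, relu_mul _ _ hCN]
        simp [relu]; ring
      · simp only [h, decide_false, if_true, lin_smul, lin_zero, reduceCtorEq, if_false, relu_mul _ _ hCN]
        simp [relu]; ring
  let c : JJ d m N → Fin (d + 1) → ℝ := fun j => match j with
    | Sum.inl z => fun i => ∑ k, cl k (α k) z i - ∑ l, cn (idx l) z i
    | Sum.inr (Sum.inl (l, b)) => pc (idx l) b
    | Sum.inr (Sum.inr _) => fun i => if i = 0 then β else 0
  refine ⟨c, ?_, ?_⟩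
  · have hcb : ∀ k a z i, |cl k a z i| ≤ |a| := by
      intro k a z i
      simp only [cl]; split_ifs
      · rw [abs_mul]; exact mul_le_of_le_one_right (abs_nonneg _) (hp k i)
      · simp
    have hCN : C / N ≤ C := div_le_self hC.le hN1
    have hCN0 : 0 ≤ C / N := by positivity
    have hnb : ∀ o z i, |cn o z i| ≤ C / N := by
      rintro (_ | k) z i
      · simp only [cn, abs_zero]; exact hCN0
      · refine (hcb _ _ _ _).trans ?_
        rw [abs_mul, abs_sg, mul_one, abs_of_nonneg hCN0]
    have hβ := abs_nonneg β
    rintro (z | ⟨l, b⟩ | _) i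
    · simp only [c]
      have h1 : |∑ k, cl k (α k) z i| ≤ C := (Finset.abs_sum_le_sum_abs _ _).trans ((Finset.sum_le_sum fun k _ => hcb _ _ _ _).trans hα)
      have h2 : |∑ l, cn (idx l) z i| ≤ C := by
        refine (Finset.abs_sum_le_sum_abs _ _).trans ((Finset.sum_le_sum fun l _ => hnb (idx l) z i).trans ?_)
        simp; field_simp; exact le_rfl
      have := abs_sub (∑ k, cl k (α k) z i) (∑ l, cn (idx l) z i)
      linarith
    · simp only [c]
      have : ∀ o, |pc o b i| ≤ C / N := by
        rintro (_ | k)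
        · simp only [pc, abs_zero]; exact hCN0
        · simp only [pc]; split_ifs
          · rw [abs_mul, abs_of_nonneg hCN0]; exact mul_le_of_le_one_right hCN0 (hp k i)
          · simpa using hCN0
      linarith [this (idx l)]
    · simp only [c]; split_ifs
      · linarith
      · simp; linarith
  · have hg : ∀ x, gfun c x = ∑ k, α k * (lin (p k) x * indz m (zr m (p k)) x) + (1 / N) * ∑ l, u (idx l) x + β := by
      intro x
      simp only [gfun, Fintype.sum_sum_type, Fintype.sum_prod_type, phi, c, Fintype.univ_bool, Finset.sum_pair (show true ≠ false by simp)]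
      have h1 : ∀ z : {z : Fin (d + 1) → ℤ // z ∈ Zf d m}, lin (fun i => ∑ k, cl k (α k) z i - ∑ l, cn (idx l) z i) x = ∑ k, lin (cl k (α k) z) x - ∑ l, lin (cn (idx l) z) x := by
        intro z
        rw [← lin_sum, ← lin_sum, lin_sub]
      have h2 : lin (fun i : Fin (d + 1) => if i = 0 then β else 0) x = β := by simp [lin, Fin.succ_ne_zero]
      simp only [h1, h2, sub_mul, Finset.sum_sub_distrib, Finset.sum_mul]
      have h4 : ∑ z : {z : Fin (d + 1) → ℤ // z ∈ Zf d m}, ∑ l, lin (cn (idx l) z) x * indz m z.1 x = ∑ l, ∑ z : {z : Fin (d + 1) → ℤ // z ∈ Zf d m}, lin (cn (idx l) z) x * indz m z.1 x := Finset.sum_comm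
      rw [h4, Finset.sum_comm]
      simp only [hcl]
      have h3 : ∑ l, (1 / (N : ℝ)) * u (idx l) x = ∑ l, (relu (lin (pc (idx l) true) x) - relu (lin (pc (idx l) false) x) - ∑ z, lin (cn (idx l) z) x * indz m z.1 x) :=
        Finset.sum_congr rfl fun l _ => (hcn (idx l) x).symm
      rw [Finset.sum_sub_distrib, Finset.sum_sub_distrib] at h3
      rw [Finset.mul_sum, h3]
      simp only [Finset.sum_add_distrib, Finset.sum_neg_distrib, Finset.univ_unique, Finset.sum_singleton]
      ring
    have hE : ∀ x, (∑ k, α k * relu (lin (p k) x) + β - gfun c x) ^ 2 = (1 / N ^ 2) * (∑ l, u (idx l) x - N * ∑ o, lam o * u o x) ^ 2 := by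
      intro x
      rw [hg, hv]
      have : ∑ k, α k * resid m (p k) x = ∑ k, α k * relu (lin (p k) x) - ∑ k, α k * (lin (p k) x * indz m (zr m (p k)) x) := by
        rw [← Finset.sum_sub_distrib]
        exact Finset.sum_congr rfl fun k _ => by rw [hrs]; ring
      rw [this]
      field_simp
      ring
    simp_rw [hE]
    rw [integral_const_mul]
    calc _ ≤ 1 / (N : ℝ) ^ 2 * (N * (C ^ 2 * om ^ 2 * σ)) := by gcongr
      _ = _ := by field_simp

lemma relu_lip (s t : ℝ) : |relu s - relu t| ≤ |s - t| := abs_max_sub_max_le_abs s t 0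

lemma phi_lip {d m N : ℕ} (j : JJ d m N) (s t : ℝ) (x : Euc d) : |phi j s x - phi j t x| ≤ |s - t| := by
  rcases j with z | ⟨l, b⟩ | _
  · simp only [phi, ← sub_mul, abs_mul]
    refine mul_le_of_le_one_right (abs_nonneg _) ?_
    unfold indz; split_ifs <;> simp
  · cases b
    · simp only [phi]
      rw [show -relu s - -relu t = -(relu s - relu t) by ring, abs_neg]
      exact relu_lip s t
    · exact relu_lip s t
  · exact le_rfl

lemma gfun_lip {d m N : ℕ} (c c' : JJ d m N → Fin (d + 1) → ℝ) (τ : ℝ) (h : ∀ j i, |c j i - c' j i| ≤ τ)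
    (x : Euc d) (hx : ‖x‖ ≤ 1) : |gfun c x - gfun c' x| ≤ Fintype.card (JJ d m N) * ((d + 1) * τ) := by
  unfold gfun
  rw [← Finset.sum_sub_distrib]
  refine (Finset.abs_sum_le_sum_abs _ _).trans ?_
  calc _ ≤ ∑ j : JJ d m N, ((d + 1) * τ) := by
        refine Finset.sum_le_sum fun j _ => (phi_lip _ _ _ _).trans ?_
        rw [lin_sub]
        exact lin_bound _ τ (h j) x hx
    _ = _ := by rw [Finset.sum_const, nsmul_eq_mul, Finset.card_univ]

lemma indz_measurable {d : ℕ} (m : ℕ) (z : Fin (d + 1) → ℤ) : Measurable (indz m z : Euc d → ℝ) :=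
  Measurable.ite (measurableSet_lt measurable_const (lin_continuous _).measurable) measurable_const measurable_const

lemma gfun_measurable {d m N : ℕ} (c : JJ d m N → Fin (d + 1) → ℝ) : Measurable (gfun c) := by
  unfold gfun
  refine Finset.measurable_sum _ fun j _ => ?_
  have hl := (lin_continuous (c j)).measurable
  rcases j with z | ⟨l, b⟩ | _
  · exact hl.mul (indz_measurable m z.1)
  · cases b
    · exact (relu_measurable.comp hl).neg
    · exact relu_measurable.comp hl
  · exact hl

def GF (d m N T : ℕ) : Finset (JJ d m N → Fin (d + 1) → ℤ) :=
  Fintype.piFinset fun _ => Fintype.piFinset fun _ => Finset.Icc (-(T : ℤ)) T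

lemma GF_card (d m N T : ℕ) : (GF d m N T).card = (2 * T + 1) ^ ((d + 1) * Fintype.card (JJ d m N)) := by
  have e : ((T : ℤ) + 1 - -(T : ℤ)).toNat = 2 * T + 1 := by omega
  simp only [GF, Fintype.card_piFinset, Int.card_Icc, Finset.prod_const, Finset.card_univ, Fintype.card_fin, e, ← pow_mul]

def gq {d m N : ℕ} (τ : ℝ) (k : JJ d m N → Fin (d + 1) → ℤ) : Euc d → ℝ := gfun fun j i => τ * k j i

lemma quant {d m N T : ℕ} (τ : ℝ) (hτ : 0 < τ) (c : JJ d m N → Fin (d + 1) → ℝ) (hc : ∀ j i, |c j i| ≤ τ * T) :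
    ∃ k ∈ GF d m N T, ∀ x : Euc d, ‖x‖ ≤ 1 → |gfun c x - gq τ k x| ≤ Fintype.card (JJ d m N) * ((d + 1) * τ) := by
  refine ⟨fun j i => round (c j i / τ), ?_, fun x hx => gfun_lip _ _ τ (fun j i => ?_) x hx⟩
  · simp only [GF, Fintype.mem_piFinset, Finset.mem_Icc]
    intro j i
    have := abs_le.1 (hc j i)
    have h1 : -(T : ℝ) ≤ c j i / τ := by rw [le_div_iff₀ hτ]; linarith
    have h2 : c j i / τ ≤ T := by rw [div_le_iff₀ hτ]; linarith
    have h3 : round (-(T : ℝ)) ≤ round (c j i / τ) := by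
      rw [round_eq, round_eq]; apply Int.floor_mono; linarith
    have h4 : round (c j i / τ) ≤ round (T : ℝ) := by
      rw [round_eq, round_eq]; apply Int.floor_mono; linarith
    rw [show (-(T : ℝ)) = ((-(T : ℤ) : ℤ) : ℝ) by push_cast; ring, round_intCast] at h3
    rw [round_natCast] at h4
    exact ⟨h3, h4⟩
  · have := abs_sub_round (c j i / τ)
    rw [show c j i - τ * (round (c j i / τ) : ℝ) = τ * (c j i / τ - round (c j i / τ)) by field_simp, abs_mul, abs_of_pos hτ]
    nlinarith

lemma JJ_card (d m N : ℕ) : Fintype.card (JJ d m N) = (Zf d m).card + (N * 2 + 1) := by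
  simp [Fintype.card_sum, Fintype.card_prod]

def clp (κ t : ℝ) : ℝ := max (-κ) (min κ t)

lemma clp_abs (κ t : ℝ) (hκ : 0 ≤ κ) : |clp κ t| ≤ κ := by
  unfold clp; rw [abs_le]
  exact ⟨le_max_left _ _, max_le (by linarith) (min_le_left _ _)⟩

lemma clp_close (κ s t : ℝ) (hs : |s| ≤ κ) : |s - clp κ t| ≤ |s - t| := by
  rw [abs_le] at hs
  have e : s = clp κ s := by unfold clp; rw [min_eq_right hs.2, max_eq_right hs.1]
  calc |s - clp κ t| = |clp κ s - clp κ t| := by rw [← e]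
    _ ≤ |min κ s - min κ t| := by
      unfold clp; rw [max_comm (-κ), max_comm (-κ)]; exact abs_max_sub_max_le_abs _ _ _
    _ ≤ _ := by refine (abs_min_sub_min_le_max κ s κ t).trans ?_; simp

lemma clp_measurable (κ : ℝ) : Measurable (clp κ) := by unfold clp; fun_prop

lemma exists_abs_eq_norm {d : ℕ} (q : Fin (d + 1) → ℝ) : ∃ j, |q j| = ‖q‖ := by
  obtain ⟨j, -, hj⟩ := Finset.exists_max_image Finset.univ (fun j => |q j|) Finset.univ_nonempty
  refine ⟨j, le_antisymm (norm_le_pi_norm q j) ?_⟩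
  exact (pi_norm_le_iff_of_nonneg (abs_nonneg _)).2 fun i => hj i (Finset.mem_univ _)

lemma net_rep {d K n : ℕ} (hd : 1 ≤ d) (hn : 0 < n) (x : Fin n → Euc d) (y : Fin n → ℝ) (θ : Params d K)
    (η κ ε pp : ℝ) (hη : 0 < η) (hκ : 0 ≤ κ) (hε0 : 0 < ε) (hε1 : ε ≤ 1) (hpp : 0 < pp)
    (hr : ∀ i, |y i - netFun θ (x i)| ≤ 2 * κ) (hf0 : |netFun θ 0| ≤ κ)
    (hC : ContDiffAt ℝ 2 (empLoss n x y) θ) (hl : lambdaMax (empLoss n x y) θ ≤ 2 / η)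
    (hcap : ∀ u : Euc d, ‖u‖ = 1 → pp ≤ avg x (fun z => if 1 - ε / 2 < ∑ j, u j * z j then (1 : ℝ) else 0)) :
    ∃ (ι : Type) (_ : Fintype ι) (α : ι → ℝ) (p : ι → Fin (d + 1) → ℝ) (β : ℝ),
      (∀ k j, |p k j| ≤ 1) ∧ (∀ k, ∃ j, |p k j| = 1) ∧ ∑ k, |α k| ≤ (1 / η + κ) * (2 / (ε * pp ^ 2)) ∧
      |β| ≤ κ + (1 / η + κ) * (2 / (ε * pp ^ 2)) ∧
      ∀ z : Euc d, ‖z‖ ≤ 1 - ε → netFun θ z = ∑ k, α k * relu (lin (p k) z) + β := by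
  have hn' : (0 : ℝ) < n := by exact_mod_cast hn
  let W : Fin K → Euc d := fun k => WithLp.toLp 2 (wP θ k)
  have hW : ∀ k (z : Euc d), ∑ j, wP θ k j * z j = inner ℝ (W k) z := by
    intro k z; simp [W, PiLp.inner_apply, mul_comm]
  let q : Fin K → Fin (d + 1) → ℝ := fun k => Fin.cons (-bP θ k) (wP θ k)
  have hq : ∀ k z, lin (q k) z = (∑ j, wP θ k j * z j) - bP θ k := by
    intro k z; simp [lin, q]; ring
  have hq' : ∀ k j, |q k j| ≤ max |bP θ k| ‖W k‖ := by
    intro k j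
    refine Fin.cases ?_ (fun j => ?_) j
    · simp [q]
    · simp only [q, Fin.cons_succ]
      exact (abs_coord_le (W k) j).trans (le_max_right _ _)
  have hSle : ∀ k, ‖q k‖ ≤ max |bP θ k| ‖W k‖ := fun k =>
    (pi_norm_le_iff_of_nonneg (le_max_of_le_left (abs_nonneg _))).2 (hq' k)
  have hball : ∀ k, ∃ u : Euc d, ‖u‖ = 1 ∧ W k = ‖W k‖ • u := by
    intro k
    by_cases h : W k = 0
    · exact ⟨EuclideanSpace.single ⟨0, hd⟩ 1, by simp, by simp [h]⟩
    · have h' : ‖W k‖ ≠ 0 := norm_ne_zero_iff.2 h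
      exact ⟨‖W k‖⁻¹ • W k, by rw [norm_smul, norm_inv, norm_norm, inv_mul_cancel₀ h'], by rw [smul_smul, mul_inv_cancel₀ h', one_smul]⟩
  let ι := {k : Fin K // bP θ k < ‖W k‖ * (1 - ε)}
  have hS : ∀ k : ι, 0 < ‖q k.1‖ := by
    rintro ⟨k, hk⟩
    rw [norm_pos_iff]
    intro h0
    have h1 : bP θ k = 0 := by have := congrFun h0 0; simpa [q] using this
    have h2 : W k = 0 := by
      ext j; have := congrFun h0 j.succ; simpa [q] using this
    simp [h1, h2] at hk
  have hsw := stable_weight hn x y θ η κ hη hκ hr hC hl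
  set A := 1 / η + κ with hA
  have hz : ∀ k : ι, ∀ u : Euc d, ‖u‖ = 1 → W k.1 = ‖W k.1‖ • u → ∀ i, 1 - ε / 2 < ∑ j, u j * x i j → ‖q k.1‖ * (ε / 2) ≤ zP x θ k.1 i := by
    rintro ⟨k, hk⟩ u hu hWu i hi
    have e : zP x θ k i = ‖W k‖ * (∑ j, u j * x i j) - bP θ k := by
      simp only [zP]
      rw [hW, hWu, inner_smul_left, norm_smul, hu]
      simp [PiLp.inner_apply, mul_comm]
    show ‖q k‖ * (ε / 2) ≤ zP x θ k i
    rw [e]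
    have h1 := norm_nonneg (W k)
    have h2 : ‖W k‖ * (1 - ε / 2) ≤ ‖W k‖ * ∑ j, u j * x i j := mul_le_mul_of_nonneg_left hi.le h1
    refine (mul_le_mul_of_nonneg_right (hSle k) (by positivity)).trans ?_
    rcases le_total |bP θ k| ‖W k‖ with h | h
    · rw [max_eq_right h]; nlinarith
    · rw [max_eq_left h]
      rcases le_or_gt 0 (bP θ k) with hb | hb
      · rw [abs_of_nonneg hb] at h ⊢; nlinarith
      · rw [abs_of_neg hb] at h ⊢; nlinarith
  have hsum : ∑ k : ι, |vP θ k.1 * ‖q k.1‖| ≤ A * (2 / (ε * pp ^ 2)) := by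
    have h1 : ∀ k : ι, |vP θ k.1 * ‖q k.1‖| * (ε * pp ^ 2 / 2) ≤ |vP θ k.1| * ((1 / (n : ℝ)) * ∑ i, relu (zP x θ k.1 i)) *
      ((1 / (n : ℝ)) * ∑ i, if 0 < zP x θ k.1 i then (1 : ℝ) else 0) := by
      intro k
      obtain ⟨u, hu, hWu⟩ := hball k.1
      have hc := hcap u hu
      have hzk := hz k u hu hWu
      have hSk := hS k
      have a1 : ‖q k.1‖ * (ε / 2) * pp ≤ (1 / (n : ℝ)) * ∑ i, relu (zP x θ k.1 i) := by
        calc _ ≤ ‖q k.1‖ * (ε / 2) * avg x (fun z => if 1 - ε / 2 < ∑ j, u j * z j then (1 : ℝ) else 0) := by gcongr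
          _ = (1 / (n : ℝ)) * ∑ i, ‖q k.1‖ * (ε / 2) * (if 1 - ε / 2 < ∑ j, u j * x i j then (1 : ℝ) else 0) := by
            rw [← Finset.mul_sum]; unfold avg; ring
          _ ≤ _ := by
            gcongr with i
            split_ifs with h
            · rw [mul_one]; exact (hzk i h).trans (le_max_left _ _)
            · rw [mul_zero]; exact le_max_right _ _
      have a2 : pp ≤ (1 / (n : ℝ)) * ∑ i, if 0 < zP x θ k.1 i then (1 : ℝ) else 0 := by
        refine hc.trans ?_
        unfold avg
        refine mul_le_mul_of_nonneg_left (Finset.sum_le_sum fun i _ => ?_) (by positivity)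
        by_cases h : 1 - ε / 2 < ∑ j, u j * x i j
        · have h' : 0 < zP x θ k.1 i := lt_of_lt_of_le (by positivity) (hzk i h)
          simp [h, h']
        · simp only [h, if_false]
          split_ifs <;> norm_num
      rw [abs_mul, abs_of_pos hSk]
      calc |vP θ k.1| * ‖q k.1‖ * (ε * pp ^ 2 / 2) = |vP θ k.1| * (‖q k.1‖ * (ε / 2) * pp) * pp := by ring
        _ ≤ _ := by
          have := abs_nonneg (vP θ k.1)
          gcongr
          exact mul_nonneg this ((by positivity : (0:ℝ) ≤ ‖q k.1‖ * (ε / 2) * pp).trans a1)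
    have h2 : (∑ k : ι, |vP θ k.1 * ‖q k.1‖|) * (ε * pp ^ 2 / 2) ≤ A := by
      rw [Finset.sum_mul]
      refine (Finset.sum_le_sum fun k _ => h1 k).trans (le_trans ?_ hsw)
      have nn : ∀ k, 0 ≤ |vP θ k| * ((1 / (n : ℝ)) * ∑ i, relu (zP x θ k i)) *
          ((1 / (n : ℝ)) * ∑ i, if 0 < zP x θ k i then (1 : ℝ) else 0) := by
        intro k
        refine mul_nonneg (mul_nonneg (abs_nonneg _) (mul_nonneg (by positivity) (Finset.sum_nonneg fun i _ => relu_nonneg _))) (mul_nonneg (by positivity) (Finset.sum_nonneg fun i _ => ?_))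
        split_ifs <;> norm_num
      have e3 := Finset.sum_subtype (Finset.univ.filter fun k : Fin K => bP θ k < ‖W k‖ * (1 - ε)) (p := fun k => bP θ k < ‖W k‖ * (1 - ε)) (F := inferInstance) (by simp)
        (fun k => |vP θ k| * ((1 / (n : ℝ)) * ∑ i, relu (zP x θ k i)) * ((1 / (n : ℝ)) * ∑ i, if 0 < zP x θ k i then (1 : ℝ) else 0))
      refine (le_of_eq e3.symm).trans ?_
      exact Finset.sum_le_sum_of_subset_of_nonneg (Finset.filter_subset _ _) fun k _ _ => nn k
    rw [← le_div_iff₀ (by positivity)] at h2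
    refine h2.trans (le_of_eq ?_)
    field_simp
  have hrep : ∀ z : Euc d, ‖z‖ ≤ 1 - ε → netFun θ z = ∑ k : ι, (vP θ k.1 * ‖q k.1‖) * relu (lin (fun j => ‖q k.1‖⁻¹ * q k.1 j) z) + betaP θ := by
    intro z hz
    unfold netFun
    congr 1
    have e1 : ∀ k : ι, (vP θ k.1 * ‖q k.1‖) * relu (lin (fun j => ‖q k.1‖⁻¹ * q k.1 j) z) = vP θ k.1 * relu ((∑ j, wP θ k.1 j * z j) - bP θ k.1) := by
      intro k
      have := hS k
      rw [lin_smul, relu_mul _ _ (by positivity), hq]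
      field_simp
    simp_rw [e1]
    have e3 := Finset.sum_subtype (Finset.univ.filter fun k : Fin K => bP θ k < ‖W k‖ * (1 - ε)) (p := fun k => bP θ k < ‖W k‖ * (1 - ε)) (F := inferInstance) (by simp)
        (fun k => vP θ k * relu ((∑ j, wP θ k j * z j) - bP θ k))
    refine Eq.trans ?_ e3
    rw [Finset.sum_filter]
    refine Finset.sum_congr rfl fun k _ => ?_
    split_ifs with h
    · rfl
    · have h1 := real_inner_le_norm (W k) z
      have h2 : ‖W k‖ * ‖z‖ ≤ ‖W k‖ * (1 - ε) := by gcongr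
      rw [hW, relu, max_eq_right (by linarith), mul_zero]
  refine ⟨ι, inferInstance, fun k => vP θ k.1 * ‖q k.1‖, fun k j => ‖q k.1‖⁻¹ * q k.1 j, betaP θ, ?_, ?_, hsum, ?_, hrep⟩
  · intro k j
    rw [abs_mul, abs_of_pos (inv_pos.2 (hS k)), inv_mul_le_iff₀ (hS k), mul_one]
    exact norm_le_pi_norm (q k.1) j
  · intro k
    obtain ⟨j, hj⟩ := exists_abs_eq_norm (q k.1)
    exact ⟨j, by rw [abs_mul, abs_of_pos (inv_pos.2 (hS k)), hj, inv_mul_cancel₀ (hS k).ne']⟩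
  · have h0 := hrep 0 (by simp; exact hε1)
    have h1 : |∑ k : ι, (vP θ k.1 * ‖q k.1‖) * relu (lin (fun j => ‖q k.1‖⁻¹ * q k.1 j) (0 : Euc d))| ≤ A * (2 / (ε * pp ^ 2)) := by
      refine (Finset.abs_sum_le_sum_abs _ _).trans (le_trans (Finset.sum_le_sum fun k _ => ?_) hsum)
      rw [abs_mul]
      refine mul_le_of_le_one_right (abs_nonneg _) ?_
      rw [abs_of_nonneg (relu_nonneg _)]
      refine max_le ?_ zero_le_one
      simp only [lin, PiLp.zero_apply, mul_zero, Finset.sum_const_zero, add_zero]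
      rw [inv_mul_le_iff₀ (hS k), mul_one]
      exact (le_abs_self _).trans (norm_le_pi_norm (q k.1) 0)
    have : betaP θ = netFun θ 0 - ∑ k : ι, (vP θ k.1 * ‖q k.1‖) * relu (lin (fun j => ‖q k.1‖⁻¹ * q k.1 j) (0 : Euc d)) := by
      rw [h0]; ring
    rw [this]
    refine (abs_sub _ _).trans ?_
    linarith

/-- empirical measure -/
def emp {E : Type*} [MeasurableSpace E] {n : ℕ} (ω : Fin n → E) : Measure E :=
  ((n : ℝ≥0∞)⁻¹) • ∑ i, Measure.dirac (ω i)

lemma emp_prob {E : Type*} [MeasurableSpace E] {n : ℕ} (hn : 0 < n) (ω : Fin n → E) : IsProbabilityMeasure (emp ω) := by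
  constructor
  simp only [emp, Measure.smul_apply, Measure.finsetSum_apply, measure_univ, smul_eq_mul]
  simp
  exact ENNReal.inv_mul_cancel (by simp; omega) (by simp)

lemma emp_integral {E : Type*} [MeasurableSpace E] [MeasurableSingletonClass E] {n : ℕ} (ω : Fin n → E) (h : E → ℝ) :
    ∫ z, h z ∂(emp ω) = avg ω h := by
  rw [emp, integral_smul_measure, integral_finsetSum_measure (fun i _ => integrable_dirac (by simp))]
  simp [avg, integral_dirac]

lemma emp_ae {E : Type*} [MeasurableSpace E] [MeasurableSingletonClass E] {n : ℕ} (ω : Fin n → E) (p : E → Prop)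
    (h : ∀ i, p (ω i)) : ∀ᵐ z ∂(emp ω), p z := by
  rw [ae_iff, emp]
  simp [Measure.smul_apply, Measure.finsetSum_apply, h]

lemma emp_map {E F : Type*} [MeasurableSpace E] [MeasurableSpace F] {n : ℕ} (ω : Fin n → E) (g : E → F) (hg : Measurable g) :
    (emp ω).map g = emp (fun i => g (ω i)) := by
  simp only [emp, Measure.map_smul]
  congr 1
  rw [← Measure.mapₗ_apply_of_measurable hg, map_sum]
  simp [Measure.mapₗ_apply_of_measurable hg, Measure.map_dirac' hg]

def Hf {d : ℕ} (ε : ℝ) (g : Euc d → ℝ) (z : Euc d × ℝ) : ℝ := if ‖z.1‖ ≤ 1 - ε then (g z.1 - z.2) ^ 2 else 0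

lemma gap1 {d : ℕ} (P : Measure (Euc d × ℝ)) [IsProbabilityMeasure P] (κ ε t a : ℝ) (hκ : 0 ≤ κ) (ht : 0 < t)
    (hP : ∀ᵐ z ∂P, ‖z.1‖ ≤ 1 ∧ |z.2| ≤ κ) (f g : Euc d → ℝ) (hfm : Measurable f) (hgm : Measurable g)
    (hf : ∀ x, ‖x‖ ≤ 1 → |f x| ≤ κ) (hg : ∀ x, |g x| ≤ κ)
    (ha : P.real {z | 1 - ε < ‖z.1‖} ≤ a) :
    |(∫ z, (f z.1 - z.2) ^ 2 ∂P) - ∫ z, Hf ε g z ∂P| ≤ 4 * κ ^ 2 * a +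
      2 * κ / t * (∫ x in Metric.closedBall 0 (1 - ε), (f x - g x) ^ 2 ∂(P.map Prod.fst)) + 2 * κ * t := by
  have hB : ∀ A : ℝ, ∀ B : ℝ, |A| ≤ κ → |B| ≤ κ → (A - B) ^ 2 ≤ 4 * κ ^ 2 := by
    intro A B hA hB
    have : |A - B| ≤ 2 * κ := (abs_sub A B).trans (by linarith)
    calc (A - B) ^ 2 = |A - B| ^ 2 := (sq_abs _).symm
      _ ≤ (2 * κ) ^ 2 := by gcongr
      _ = _ := by ring
  have hs1 : MeasurableSet {z : Euc d × ℝ | 1 - ε < ‖z.1‖} := measurableSet_lt measurable_const measurable_fst.norm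
  have hs2 : MeasurableSet {z : Euc d × ℝ | ‖z.1‖ ≤ 1 - ε} := measurableSet_le measurable_fst.norm measurable_const
  have m1 : Measurable fun z : Euc d × ℝ => (f z.1 - z.2) ^ 2 := ((hfm.comp measurable_fst).sub measurable_snd).pow_const 2
  have m2 : Measurable fun z : Euc d × ℝ => Hf ε g z :=
    Measurable.ite hs2 (((hgm.comp measurable_fst).sub measurable_snd).pow_const 2) measurable_const
  have i1 : Integrable (fun z : Euc d × ℝ => (f z.1 - z.2) ^ 2) P := by
    refine Integrable.of_bound m1.aestronglyMeasurable (4 * κ ^ 2) ?_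
    filter_upwards [hP] with z hz
    rw [Real.norm_of_nonneg (sq_nonneg _)]
    exact hB _ _ (hf _ hz.1) hz.2
  have i2 : Integrable (fun z : Euc d × ℝ => Hf ε g z) P := by
    refine Integrable.of_bound m2.aestronglyMeasurable (4 * κ ^ 2) ?_
    filter_upwards [hP] with z hz
    unfold Hf
    split_ifs
    · rw [Real.norm_of_nonneg (sq_nonneg _)]
      exact hB _ _ (hg _) hz.2
    · simp; positivity
  have i3 : Integrable ({z : Euc d × ℝ | 1 - ε < ‖z.1‖}.indicator fun _ => 4 * κ ^ 2) P := (integrable_const _).indicator hs1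
  have i4 : Integrable ({z : Euc d × ℝ | ‖z.1‖ ≤ 1 - ε}.indicator fun z => (f z.1 - g z.1) ^ 2) P := by
    refine Integrable.of_bound ((((hfm.comp measurable_fst).sub (hgm.comp measurable_fst)).pow_const 2).indicator hs2).aestronglyMeasurable (4 * κ ^ 2) ?_
    filter_upwards [hP] with z hz
    simp only [Set.indicator]
    split_ifs
    · rw [Real.norm_of_nonneg (sq_nonneg _)]
      exact hB _ _ (hf _ hz.1) (hg _)
    · simp; positivity
  have e4 : ∫ z, {z : Euc d × ℝ | ‖z.1‖ ≤ 1 - ε}.indicator (fun z => (f z.1 - g z.1) ^ 2) z ∂P = ∫ x in Metric.closedBall 0 (1 - ε), (f x - g x) ^ 2 ∂(P.map Prod.fst) := by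
    have m3 : Measurable fun x => (f x - g x) ^ 2 := (hfm.sub hgm).pow_const 2
    rw [← integral_indicator Metric.isClosed_closedBall.measurableSet, integral_map measurable_fst.aemeasurable
      (m3.indicator Metric.isClosed_closedBall.measurableSet).aestronglyMeasurable]
    congr 1
    ext z
    simp [Set.indicator]
  rw [← e4, ← integral_sub i1 i2]
  refine abs_integral_le_integral_abs.trans ?_
  calc ∫ z, |(f z.1 - z.2) ^ 2 - Hf ε g z| ∂P ≤ ∫ z, (({z : Euc d × ℝ | 1 - ε < ‖z.1‖}.indicator (fun _ => 4 * κ ^ 2) z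
      + 2 * κ / t * {z : Euc d × ℝ | ‖z.1‖ ≤ 1 - ε}.indicator (fun z => (f z.1 - g z.1) ^ 2) z) + 2 * κ * t) ∂P := by
        refine integral_mono_ae (i1.sub i2).abs ((i3.add (i4.const_mul _)).add (integrable_const _)) ?_
        filter_upwards [hP] with z hz
        simp only [Hf, Set.indicator, Set.mem_ofPred_eq]
        by_cases h : ‖z.1‖ ≤ 1 - ε
        · have h' : ¬ (1 - ε < ‖z.1‖) := not_lt.2 h
          simp only [h, h', if_true, if_false]
          have h1 : |f z.1 - z.2 + (g z.1 - z.2)| ≤ 4 * κ := by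
            have := abs_le.1 (hf _ hz.1); have := abs_le.1 (hg z.1); have := abs_le.1 hz.2
            rw [abs_le]; constructor <;> linarith
          rw [show (f z.1 - z.2) ^ 2 - (g z.1 - z.2) ^ 2 = (f z.1 - z.2 + (g z.1 - z.2)) * (f z.1 - g z.1) by ring, abs_mul, zero_add]
          set e := f z.1 - g z.1
          have h2 : 2 * |e| ≤ e ^ 2 / t + t := by
            rw [← sq_abs e]
            have : |e| ^ 2 / t + t - 2 * |e| = (|e| - t) ^ 2 / t := by field_simp; ring
            have : 0 ≤ (|e| - t) ^ 2 / t := by positivity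
            linarith
          calc _ ≤ 4 * κ * |e| := by gcongr
            _ = 2 * κ * (2 * |e|) := by ring
            _ ≤ 2 * κ * (e ^ 2 / t + t) := by gcongr
            _ = _ := by ring
        · have h' : 1 - ε < ‖z.1‖ := not_le.1 h
          simp only [h, h', if_true, if_false, sub_zero, mul_zero, add_zero]
          rw [abs_of_nonneg (sq_nonneg _)]
          have := hB _ _ (hf _ hz.1) hz.2
          have : 0 ≤ 2 * κ * t := by positivity
          linarith
    _ = 4 * κ ^ 2 * P.real {z | 1 - ε < ‖z.1‖} + 2 * κ / t * ∫ z, {z : Euc d × ℝ | ‖z.1‖ ≤ 1 - ε}.indicator (fun z => (f z.1 - g z.1) ^ 2) z ∂P + 2 * κ * t := by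
        have i5 : Integrable (fun z => {z : Euc d × ℝ | 1 - ε < ‖z.1‖}.indicator (fun _ => 4 * κ ^ 2) z
      + 2 * κ / t * {z : Euc d × ℝ | ‖z.1‖ ≤ 1 - ε}.indicator (fun z => (f z.1 - g z.1) ^ 2) z) P := i3.add (i4.const_mul _)
        rw [integral_add i5 (integrable_const _), integral_add i3 (i4.const_mul _), integral_indicator_const _ hs1, integral_const_mul]
        simp [mul_comm]
    _ ≤ _ := by gcongr

lemma netFun_continuous {d K : ℕ} (θ : Params d K) : Continuous (netFun θ) := by
  unfold netFun relu; fun_prop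

lemma det_main {d K n : ℕ} (hd : 1 ≤ d) (hn : 0 < n) (P : Measure (Euc d × ℝ)) [IsProbabilityMeasure P]
    (hmap : P.map Prod.fst = uniformBall d) (ω : Fin n → Euc d × ℝ) (θ : Params d K)
    (η κ ε pp σ a Δ τ t : ℝ) (m N T : ℕ) (hm : 0 < m) (hN : 0 < N) (hη : 0 < η) (hκ : 0 < κ)
    (hε0 : 0 < ε) (hε1 : ε ≤ 1) (hpp : 0 < pp) (hτ : 0 < τ) (ht : 0 < t)
    (hP : ∀ᵐ z ∂P, ‖z.1‖ ≤ 1 ∧ |z.2| ≤ κ) (hω : ∀ i, ‖(ω i).1‖ ≤ 1 ∧ |(ω i).2| ≤ κ)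
    (hf : ∀ x, ‖x‖ ≤ 1 → |netFun θ x| ≤ κ)
    (hC2 : ContDiffAt ℝ 2 (empLoss n (fun i => (ω i).1) (fun i => (ω i).2)) θ)
    (hl : lambdaMax (empLoss n (fun i => (ω i).1) (fun i => (ω i).2)) θ ≤ 2 / η)
    (hcap : ∀ u : Euc d, ‖u‖ = 1 → pp ≤ avg (fun i => (ω i).1) (fun z => if 1 - ε / 2 < ∑ j, u j * z j then (1 : ℝ) else 0))
    (hslab : ∀ z ∈ Zf d m, avg (fun i => (ω i).1) ({x : Euc d | |lin (qz m z) x| ≤ (d + 1) / m}.indicator fun _ => (1 : ℝ)) ≤ σ)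
    (hann : avg (fun i => (ω i).1) ({x : Euc d | 1 - ε < ‖x‖}.indicator fun _ => (1 : ℝ)) ≤ a)
    (hG : ∀ k ∈ GF d m N T, |(∫ z, Hf ε (fun x => clp κ (gq τ k x)) z ∂P) - avg ω (Hf ε (fun x => clp κ (gq τ k x)))| ≤ Δ)
    (C : ℝ) (hC : C = (1 / η + κ) * (2 / (ε * pp ^ 2))) (hT : κ + 3 * C ≤ τ * T) :
    |(∫ z, (netFun θ z.1 - z.2) ^ 2 ∂P) - avg ω (fun z => (netFun θ z.1 - z.2) ^ 2)| ≤
      4 * κ ^ 2 * (d * ε + a) + Δ + 2 * κ / t * (2 * (C ^ 2 * ((d + 1) / m) ^ 2 * (12 * 2 ^ d * ((d + 1) / m) + σ) / N) +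
        4 * (Fintype.card (JJ d m N) * ((d + 1) * τ)) ^ 2) + 4 * κ * t := by
  set x : Fin n → Euc d := fun i => (ω i).1 with hx
  set y : Fin n → ℝ := fun i => (ω i).2 with hy
  have hC0 : 0 < C := by rw [hC]; positivity
  haveI := emp_prob hn x
  haveI := emp_prob hn ω
  obtain ⟨ι, hι, α, p, β, hp, hp1, hα, hβ, hrep⟩ := net_rep hd hn x y θ η κ ε pp hη hκ.le hε0 hε1 hpp
    (fun i => (abs_sub _ _).trans (by linarith [hf _ (hω i).1, (hω i).2])) (hf 0 (by simp)) hC2 hl hcap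
  rw [← hC] at hα hβ
  set I : Set (Euc d) := Metric.closedBall 0 (1 - ε) with hI
  have hIm : MeasurableSet I := Metric.isClosed_closedBall.measurableSet
  set Q : Measure (Euc d) := (uniformBall d + emp x).restrict I with hQ
  have hQI : ∀ᵐ z ∂Q, ‖z‖ ≤ 1 - ε := by
    filter_upwards [ae_restrict_mem hIm] with z hz
    simpa [hI] using hz
  have hQ1 : ∀ᵐ z ∂Q, ‖z‖ ≤ 1 := by filter_upwards [hQI] with z hz; linarith
  have hQs : ∀ z ∈ Zf d m, Q.real {x | |lin (qz m z) x| ≤ (d + 1) / m} ≤ 12 * 2 ^ d * ((d + 1) / m) + σ := by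
    intro z hz
    have hms : MeasurableSet {x : Euc d | |lin (qz m z) x| ≤ (d + 1) / m} :=
      measurableSet_le (lin_continuous _).measurable.abs measurable_const
    have h1 : Q.real {x | |lin (qz m z) x| ≤ (d + 1) / m} ≤ (uniformBall d + emp x).real {x | |lin (qz m z) x| ≤ (d + 1) / m} :=
      ENNReal.toReal_mono (measure_ne_top _ _) (Measure.restrict_apply_le _ _)
    rw [measureReal_add_apply] at h1
    have h2 := unif_slab (qz m z) (Zf_one m hm z hz) ((d + 1) / m) (by positivity)
    have h3 : (emp x).real {x | |lin (qz m z) x| ≤ (d + 1) / m} ≤ σ := by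
      have := hslab z hz
      rw [← emp_integral, integral_indicator_const _ hms] at this
      simpa using this
    linarith
  obtain ⟨c, hcb, hcE⟩ := approx hm hN Q hQ1 _ hQs α p hp hp1 β C hC0 hα
  obtain ⟨k, hk, hkc⟩ := quant (T := T) τ hτ c (fun j i => (hcb j i).trans (by linarith))
  set g : Euc d → ℝ := fun x => clp κ (gq τ k x) with hg
  have hgm : Measurable g := (clp_measurable κ).comp (gfun_measurable _)
  have hfm : Measurable (netFun θ) := (netFun_continuous θ).measurable
  have hgb : ∀ x, |g x| ≤ κ := fun x => clp_abs κ _ hκ.le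
  set err : ℝ := Fintype.card (JJ d m N) * ((d + 1) * τ) with herr
  have hE : ∫ x, (netFun θ x - g x) ^ 2 ∂Q ≤ 2 * (C ^ 2 * ((d + 1) / m) ^ 2 * (12 * 2 ^ d * ((d + 1) / m) + σ) / N) + 4 * err ^ 2 := by
    have hmem : MemLp (fun x => ∑ k, α k * relu (lin (p k) x) + β - gfun c x) 2 Q := by
      refine MemLp.of_bound ?_ (∑ k, |α k| * (d + 1) + |β| + ∑ _j : JJ d m N, ((d : ℝ) + 1) * (|β| + 2 * C)) ?_
      · refine Measurable.aestronglyMeasurable ?_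
        refine (Measurable.add_const (Finset.measurable_sum _ fun k _ => ?_) _).sub (gfun_measurable c)
        exact (relu_measurable.comp (lin_continuous _).measurable).const_mul _
      · filter_upwards [hQ1] with z hz
        rw [Real.norm_eq_abs]
        have b1 : |∑ k, α k * relu (lin (p k) z)| ≤ ∑ k, |α k| * (d + 1) := by
          refine (Finset.abs_sum_le_sum_abs _ _).trans (Finset.sum_le_sum fun k _ => ?_)
          rw [abs_mul]
          gcongr
          have := relu_lip (lin (p k) z) 0
          have h0 : relu 0 = 0 := by simp [relu]
          rw [h0, sub_zero, sub_zero] at this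
          refine this.trans ?_
          have := lin_bound (p k) 1 (hp k) z hz
          linarith
        have b2 : |gfun c z| ≤ ∑ j : JJ d m N, (d + 1) * (|β| + 2 * C) := by
          refine (Finset.abs_sum_le_sum_abs _ _).trans (Finset.sum_le_sum fun j _ => ?_)
          have h0 : phi j 0 z = 0 := by
            rcases j with j | ⟨l, b⟩ | _
            · simp [phi]
            · cases b <;> simp [phi, relu]
            · simp [phi]
          have := phi_lip j (lin (c j) z) 0 z
          rw [h0, sub_zero, sub_zero] at this
          exact this.trans (lin_bound (c j) _ (hcb j) z hz)
        refine (abs_sub _ _).trans ?_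
        have := abs_add_le (∑ k, α k * relu (lin (p k) z)) β
        linarith
    calc ∫ x, (netFun θ x - g x) ^ 2 ∂Q ≤ ∫ x, (2 * (∑ k, α k * relu (lin (p k) x) + β - gfun c x) ^ 2 + 2 * err ^ 2) ∂Q := by
          refine integral_mono_of_nonneg (ae_of_all _ fun x => sq_nonneg _) ((hmem.integrable_sq.const_mul 2).add (integrable_const _)) ?_
          filter_upwards [hQI] with z hz
          have hz1 : ‖z‖ ≤ 1 := by linarith
          have h1 := clp_close κ (netFun θ z) (gq τ k z) (hf z hz1)
          have h2 := hkc z hz1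
          rw [← hrep z hz]
          have h3 : |netFun θ z - g z| ≤ |netFun θ z - gfun c z| + err := by
            refine h1.trans ((abs_sub_le _ (gfun c z) _).trans ?_)
            linarith
          calc (netFun θ z - g z) ^ 2 = |netFun θ z - g z| ^ 2 := (sq_abs _).symm
            _ ≤ (|netFun θ z - gfun c z| + err) ^ 2 := by gcongr
            _ ≤ 2 * |netFun θ z - gfun c z| ^ 2 + 2 * err ^ 2 := by nlinarith [sq_nonneg (|netFun θ z - gfun c z| - err)]
            _ = _ := by rw [sq_abs]
      _ = 2 * ∫ x, (∑ k, α k * relu (lin (p k) x) + β - gfun c x) ^ 2 ∂Q + Q.real Set.univ * (2 * err ^ 2) := by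
          rw [integral_add (hmem.integrable_sq.const_mul 2) (integrable_const _), integral_const_mul, integral_const, smul_eq_mul]
      _ ≤ _ := by
          have : Q.real Set.univ ≤ 2 := by
            have h1 : Q.real Set.univ ≤ (uniformBall d + emp x).real Set.univ :=
              ENNReal.toReal_mono (measure_ne_top _ _) (Measure.restrict_apply_le _ _)
            have e1 : (uniformBall d).real Set.univ = 1 := probReal_univ
            have e2 : (emp x).real Set.univ = 1 := probReal_univ
            rw [measureReal_add_apply, e1, e2] at h1
            linarith
          nlinarith [sq_nonneg err]
  have hbd : ∀ ν : Measure (Euc d), IsFiniteMeasure ν → Integrable (fun x => (netFun θ x - g x) ^ 2) (ν.restrict I) := by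
    intro ν _
    refine Integrable.of_bound (((hfm.sub hgm).pow_const 2).aestronglyMeasurable) ((2 * κ) ^ 2) ?_
    filter_upwards [ae_restrict_mem hIm] with z hz
    have hz1 : ‖z‖ ≤ 1 := by have : ‖z‖ ≤ 1 - ε := by simpa [hI] using hz
                             linarith
    have : |netFun θ z - g z| ≤ 2 * κ := (abs_sub _ _).trans (by linarith [hf z hz1, hgb z])
    show ‖(netFun θ z - g z) ^ 2‖ ≤ _
    rw [Real.norm_of_nonneg (sq_nonneg _), ← sq_abs]
    gcongr
  have hQsplit : ∫ x, (netFun θ x - g x) ^ 2 ∂Q = (∫ x in I, (netFun θ x - g x) ^ 2 ∂(uniformBall d)) + ∫ x in I, (netFun θ x - g x) ^ 2 ∂(emp x) := by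
    rw [hQ, Measure.restrict_add, integral_add_measure (hbd _ inferInstance) (hbd _ inferInstance)]
  have hsm : MeasurableSet {z : Euc d | 1 - ε < ‖z‖} := measurableSet_lt measurable_const measurable_norm
  have g1 := gap1 P κ ε t (d * ε) hκ.le ht hP (netFun θ) g hfm hgm hf hgb (by
    have := unif_annulus (d := d) ε hε0.le hε1
    rw [← hmap, map_measureReal_apply measurable_fst hsm] at this
    exact this)
  have g2 := gap1 (emp ω) κ ε t a hκ.le ht (emp_ae ω _ hω) (netFun θ) g hfm hgm hf hgb (by
    have h := hann
    rw [← emp_integral, integral_indicator_const _ hsm, hx, ← emp_map ω Prod.fst measurable_fst, map_measureReal_apply measurable_fst hsm] at h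
    simpa using h)
  rw [hmap] at g1
  rw [emp_map ω Prod.fst measurable_fst, emp_integral, emp_integral] at g2
  have g3 := hG k hk
  set A1 := ∫ z, (netFun θ z.1 - z.2) ^ 2 ∂P
  set A2 := avg ω (fun z => (netFun θ z.1 - z.2) ^ 2)
  set H1 := ∫ z, Hf ε g z ∂P
  set H2 := avg ω (fun z => Hf ε g z)
  have g4 : |A1 - A2| ≤ |A1 - H1| + |H1 - H2| + |A2 - H2| := by
    rw [show A1 - A2 = (A1 - H1) + (H1 - H2) - (A2 - H2) by ring]
    refine (abs_sub _ _).trans ?_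
    linarith [abs_add_le (A1 - H1) (H1 - H2)]
  have g5 : 2 * κ / t * ((∫ x in I, (netFun θ x - g x) ^ 2 ∂(uniformBall d)) + ∫ x in I, (netFun θ x - g x) ^ 2 ∂(emp x)) ≤
      2 * κ / t * (2 * (C ^ 2 * ((d + 1) / m) ^ 2 * (12 * 2 ^ d * ((d + 1) / m) + σ) / N) + 4 * err ^ 2) := by
    rw [← hQsplit]; gcongr
  rw [mul_add] at g5
  have g6 : |H1 - H2| ≤ Δ := g3
  linarith [g1, g2, g4, g5, g6]

lemma prob_union {Ω I : Type*} [MeasurableSpace Ω] (μ : Measure Ω) [IsFiniteMeasure μ] (s : Finset I) (A : I → Set Ω) (e : ℝ)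
    (h : ∀ i ∈ s, μ.real (A i) ≤ e) : μ.real (⋃ i ∈ s, A i) ≤ s.card * e := by
  refine (measureReal_biUnion_finset_le s A).trans ?_
  refine (Finset.sum_le_sum h).trans ?_
  simp

lemma prob_supp {E : Type*} [MeasurableSpace E] (P : Measure E) [IsProbabilityMeasure P] (n : ℕ) (q : E → Prop)
    (h : ∀ᵐ z ∂P, q z) : (Measure.pi fun _ : Fin n => P).real {ω | ¬ ∀ i, q (ω i)} = 0 := by
  have h1 : ∀ᵐ ω ∂(Measure.pi fun _ : Fin n => P), ∀ i, q (ω i) := by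
    rw [ae_all_iff]
    intro i
    exact Measure.tendsto_eval_ae_ae.eventually h
  rw [ae_iff] at h1
  simp only [Measure.real, h1]
  rfl

lemma dot_close {d : ℕ} (u w x : Euc d) (e : ℝ) (h : ∀ j, |u j - w j| ≤ e) (hx : ‖x‖ ≤ 1) :
    |∑ j, u j * x j - ∑ j, w j * x j| ≤ d * e := by
  rw [← Finset.sum_sub_distrib]
  refine (Finset.abs_sum_le_sum_abs _ _).trans ?_
  calc _ ≤ ∑ _j : Fin d, e := by
        refine Finset.sum_le_sum fun j _ => ?_
        rw [← sub_mul, abs_mul]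
        have h1 := h j
        have h2 := (abs_coord_le x j).trans hx
        nlinarith [abs_nonneg (u j - w j), abs_nonneg (x j)]
    _ = d * e := by simp

lemma prob_cap {d n : ℕ} (hn : 0 < n) (P : Measure (Euc d × ℝ)) [IsProbabilityMeasure P]
    (hmap : P.map Prod.fst = uniformBall d) (hP : ∀ᵐ z ∂P, ‖z.1‖ ≤ 1) (ε p : ℝ) (hε0 : 0 < ε) (hε1 : ε ≤ 1) (q : ℕ)
    (hq0 : 0 < q) (hq : 8 * d ≤ ε * q) (hp : p = (√(ε / 4) / 2) ^ (d + 1)) :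
    (Measure.pi fun _ : Fin n => P).real {ω | (∀ i, ‖(ω i).1‖ ≤ 1) ∧ ¬ ∀ u : Euc d, ‖u‖ = 1 →
      p / 2 ≤ avg (fun i => (ω i).1) (fun z => if 1 - ε / 2 < ∑ j, u j * z j then (1 : ℝ) else 0)} ≤
      (2 * q + 1) ^ d * exp (-n * p ^ 2 / 2) := by
  have hp0 : 0 < p := by rw [hp]; positivity
  have hq0' : (0 : ℝ) < q := by exact_mod_cast hq0
  let w : (Fin d → ℤ) → Euc d := fun k => WithLp.toLp 2 fun j => (k j : ℝ) / q
  let S : (Fin d → ℤ) → Set (Euc d × ℝ) := fun k => {z | 1 - 3 * ε / 8 < ∑ j, w k j * z.1 j}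
  have hS : ∀ k, MeasurableSet (S k) := fun k => by
    refine measurableSet_lt measurable_const (Continuous.measurable ?_)
    fun_prop
  let F : Finset (Fin d → ℤ) := (Fintype.piFinset fun _ => Finset.Icc (-(q : ℤ)) q).filter fun k => p ≤ P.real (S k)
  let A : (Fin d → ℤ) → Set (Fin n → Euc d × ℝ) := fun k =>
    {ω | 1 * (p / 2) ≤ (∫ z, (S k).indicator (fun _ => (1 : ℝ)) z ∂P) - avg ω ((S k).indicator fun _ => (1 : ℝ))}
  have hA : ∀ k ∈ F, (Measure.pi fun _ : Fin n => P).real (A k) ≤ exp (-n * p ^ 2 / 2) := by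
    intro k _
    refine (hoeff_lower P hn _ (measurable_const.indicator (hS k)) 1 one_pos (ae_of_all _ fun z => ?_) (p / 2) (by positivity)).trans (le_of_eq ?_)
    · by_cases h : z ∈ S k <;> simp [h]
    · congr 1; ring
  have hcard : (F.card : ℝ) ≤ (2 * q + 1) ^ d := by
    have e : ((q : ℤ) + 1 - -(q : ℤ)).toNat = 2 * q + 1 := by omega
    have : F.card ≤ (2 * q + 1) ^ d := by
      refine (Finset.card_filter_le _ _).trans ?_
      simp only [Fintype.card_piFinset, Int.card_Icc, Finset.prod_const, Finset.card_univ, Fintype.card_fin, e, le_refl]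
    exact_mod_cast this
  refine (measureReal_mono (s₂ := ⋃ k ∈ F, A k) ?_ (measure_ne_top _ _)).trans ((prob_union _ F A _ hA).trans (by gcongr))
  rintro ω ⟨hω, hu⟩
  push Not at hu
  obtain ⟨u, hu1, hu⟩ := hu
  let k : Fin d → ℤ := fun j => ⌊q * u j⌋
  have huj : ∀ j, |u j| ≤ 1 := fun j => hu1 ▸ abs_coord_le u j
  have hclose : ∀ j, |u j - w k j| ≤ 1 / q := by
    intro j
    have h1 := Int.floor_le (q * u j)
    have h2 := Int.lt_floor_add_one (q * u j)
    have e : u j - w k j = (q * u j - ⌊q * u j⌋) / q := by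
      simp only [w, k]; field_simp
    rw [e, abs_of_nonneg (div_nonneg (by linarith) hq0'.le)]
    gcongr; linarith
  have hde : (d : ℝ) * (1 / q) ≤ ε / 8 := by
    rw [mul_one_div, div_le_iff₀ hq0']; linarith
  have hdot : ∀ x : Euc d, ‖x‖ ≤ 1 → |∑ j, u j * x j - ∑ j, w k j * x j| ≤ ε / 8 := fun x hx =>
    (dot_close u (w k) x _ hclose hx).trans hde
  have hk : k ∈ F := by
    simp only [F, Finset.mem_filter, Fintype.mem_piFinset, Finset.mem_Icc]
    refine ⟨fun j => ?_, ?_⟩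
    · have := abs_le.1 (huj j)
      constructor
      · apply Int.le_floor.2; push_cast; nlinarith
      · have : (⌊q * u j⌋ : ℝ) ≤ q := (Int.floor_le _).trans (by nlinarith)
        exact_mod_cast this
    · have h1 := unif_cap u hu1 (ε / 4) (by positivity) (by linarith)
      rw [← hp, ← hmap, map_measureReal_apply measurable_fst (measurableSet_lt measurable_const (Continuous.measurable (by fun_prop)))] at h1
      refine h1.trans (ENNReal.toReal_mono (measure_ne_top _ _) (measure_mono_ae ?_))
      filter_upwards [hP] with z hz h
      have h2 := abs_le.1 (hdot z.1 hz)
      have h3 : 1 - ε / 4 < ∑ j, u j * z.1 j := h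
      show 1 - 3 * ε / 8 < ∑ j, w k j * z.1 j
      linarith [h2.1]
  refine Set.mem_biUnion hk ?_
  show 1 * (p / 2) ≤ _
  rw [integral_indicator_const _ (hS k)]
  have h3 : p ≤ P.real (S k) := (Finset.mem_filter.1 hk).2
  have h4 : avg ω ((S k).indicator fun _ => (1 : ℝ)) ≤ avg (fun i => (ω i).1) (fun z => if 1 - ε / 2 < ∑ j, u j * z j then (1 : ℝ) else 0) := by
    unfold avg
    refine mul_le_mul_of_nonneg_left (Finset.sum_le_sum fun i _ => ?_) (by positivity)
    beta_reduce
    by_cases h : ω i ∈ S k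
    · have h2 := abs_le.1 (hdot _ (hω i))
      have h5 : 1 - 3 * ε / 8 < ∑ j, w k j * (ω i).1 j := h
      rw [if_pos (by linarith [h2.1])]
      simp [h]
    · rw [Set.indicator_of_notMem h]
      split_ifs <;> norm_num
  simp only [smul_eq_mul, mul_one, one_mul]
  linarith

lemma prob_slab {d n : ℕ} (hn : 0 < n) (P : Measure (Euc d × ℝ)) [IsProbabilityMeasure P]
    (hmap : P.map Prod.fst = uniformBall d) (m : ℕ) (hm : 0 < m) (s : ℝ) :
    (Measure.pi fun _ : Fin n => P).real {ω | ¬ ∀ z ∈ Zf d m, avg (fun i => (ω i).1)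
      ({x : Euc d | |lin (qz m z) x| ≤ (d + 1) / m}.indicator fun _ => (1 : ℝ)) ≤ 2 * (12 * 2 ^ d * ((d + 1) / m)) + s / n} ≤
      (Zf d m).card * exp (-s) := by
  let S : (Fin (d + 1) → ℤ) → Set (Euc d) := fun z => {x : Euc d | |lin (qz m z) x| ≤ (d + 1) / m}
  have hS : ∀ z, MeasurableSet (S z) := fun z => measurableSet_le (lin_continuous _).measurable.abs measurable_const
  let A : (Fin (d + 1) → ℤ) → Set (Fin n → Euc d × ℝ) := fun z =>
    {ω | 2 * (12 * 2 ^ d * ((d + 1) / m)) + s / n ≤ avg ω ((Prod.fst ⁻¹' S z).indicator fun _ => (1 : ℝ))}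
  have hA : ∀ z ∈ Zf d m, (Measure.pi fun _ : Fin n => P).real (A z) ≤ exp (-s) := by
    intro z hz
    refine chern P hn _ (measurable_fst (hS z)) _ s ?_
    rw [← map_measureReal_apply measurable_fst (hS z), hmap]
    exact unif_slab (qz m z) (Zf_one m hm z hz) ((d + 1) / m) (by positivity)
  refine (measureReal_mono (s₂ := ⋃ k ∈ Zf d m, A k) ?_ (measure_ne_top _ _)).trans (prob_union _ _ A _ hA)
  intro ω hω
  have hω' : ¬ ∀ z ∈ Zf d m, avg (fun i => (ω i).1)
      ({x : Euc d | |lin (qz m z) x| ≤ (d + 1) / m}.indicator fun _ => (1 : ℝ)) ≤ 2 * (12 * 2 ^ d * ((d + 1) / m)) + s / n := hω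
  push Not at hω'
  obtain ⟨z, hz, h⟩ := hω'
  refine Set.mem_biUnion hz ?_
  exact h.le

lemma prob_ann {d n : ℕ} (hn : 0 < n) (P : Measure (Euc d × ℝ)) [IsProbabilityMeasure P]
    (hmap : P.map Prod.fst = uniformBall d) (ε : ℝ) (h0 : 0 ≤ ε) (h1 : ε ≤ 1) (r : ℝ) (hr : 0 ≤ r) :
    (Measure.pi fun _ : Fin n => P).real {ω | ¬ avg (fun i => (ω i).1)
      ({x : Euc d | 1 - ε < ‖x‖}.indicator fun _ => (1 : ℝ)) ≤ d * ε + r} ≤ exp (-2 * n * r ^ 2) := by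
  have hS : MeasurableSet {x : Euc d | 1 - ε < ‖x‖} := measurableSet_lt measurable_const measurable_norm
  have h := hoeff P hn ((Prod.fst ⁻¹' {x : Euc d | 1 - ε < ‖x‖}).indicator fun _ => (1 : ℝ))
    (measurable_const.indicator (measurable_fst hS)) 1 one_pos (ae_of_all _ fun z => by
      by_cases h : z ∈ (Prod.fst ⁻¹' {x : Euc d | 1 - ε < ‖x‖} : Set (Euc d × ℝ))
      · rw [Set.indicator_of_mem h]; simp
      · rw [Set.indicator_of_notMem h]; simp) r hr
  refine le_trans (measureReal_mono ?_ (measure_ne_top _ _)) h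
  intro ω hω
  have hω' : ¬ avg (fun i => (ω i).1) ({x : Euc d | 1 - ε < ‖x‖}.indicator fun _ => (1 : ℝ)) ≤ d * ε + r := hω
  push Not at hω'
  show 1 * r ≤ _
  rw [integral_indicator_const _ (measurable_fst hS), ← map_measureReal_apply measurable_fst hS, hmap]
  have h2 := unif_annulus (d := d) ε h0 h1
  have h3 : avg ω ((Prod.fst ⁻¹' {x : Euc d | 1 - ε < ‖x‖}).indicator fun _ => (1 : ℝ)) =
    avg (fun i => (ω i).1) ({x : Euc d | 1 - ε < ‖x‖}.indicator fun _ => (1 : ℝ)) := rfl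
  simp only [smul_eq_mul, mul_one, one_mul]
  linarith

lemma prob_G {d n : ℕ} (hn : 0 < n) (P : Measure (Euc d × ℝ)) [IsProbabilityMeasure P]
    (κ ε τ : ℝ) (hκ : 0 < κ) (hP : ∀ᵐ z ∂P, ‖z.1‖ ≤ 1 ∧ |z.2| ≤ κ) (m N T : ℕ) (s : ℝ) (hs : 0 ≤ s) :
    (Measure.pi fun _ : Fin n => P).real {ω | ¬ ∀ k ∈ GF d m N T,
      |(∫ z, Hf ε (fun x => clp κ (gq τ k x)) z ∂P) - avg ω (Hf ε (fun x => clp κ (gq τ k x)))| ≤ 4 * κ ^ 2 * s} ≤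
      (GF d m N T).card * (2 * exp (-2 * n * s ^ 2)) := by
  let h : (JJ d m N → Fin (d + 1) → ℤ) → Euc d × ℝ → ℝ := fun k => Hf ε (fun x => clp κ (gq τ k x))
  have hhm : ∀ k, Measurable (h k) := by
    intro k
    have hgm : Measurable fun x : Euc d => clp κ (gq τ k x) := (clp_measurable κ).comp (gfun_measurable _)
    refine Measurable.ite (measurableSet_le measurable_fst.norm measurable_const) ?_ measurable_const
    exact ((hgm.comp measurable_fst).sub measurable_snd).pow_const 2
  have hhb : ∀ k, ∀ᵐ z ∂P, h k z ∈ Set.Icc 0 (4 * κ ^ 2) := by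
    intro k
    filter_upwards [hP] with z hz
    simp only [h, Hf]
    split_ifs
    · refine ⟨sq_nonneg _, ?_⟩
      rw [← sq_abs]
      have : |clp κ (gq τ k z.1) - z.2| ≤ 2 * κ := (abs_sub _ _).trans (by linarith [clp_abs κ (gq τ k z.1) hκ.le, hz.2])
      nlinarith [abs_nonneg (clp κ (gq τ k z.1) - z.2)]
    · exact ⟨le_rfl, by positivity⟩
  let A : (JJ d m N → Fin (d + 1) → ℤ) → Set (Fin n → Euc d × ℝ) := fun k =>
    {ω | 4 * κ ^ 2 * s ≤ avg ω (h k) - ∫ z, h k z ∂P} ∪ {ω | 4 * κ ^ 2 * s ≤ (∫ z, h k z ∂P) - avg ω (h k)}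
  have hA : ∀ k ∈ GF d m N T, (Measure.pi fun _ : Fin n => P).real (A k) ≤ 2 * exp (-2 * n * s ^ 2) := by
    intro k _
    refine (measureReal_union_le _ _).trans ?_
    have h1 := hoeff P hn (h k) (hhm k) (4 * κ ^ 2) (by positivity) (hhb k) s hs
    have h2 := hoeff_lower P hn (h k) (hhm k) (4 * κ ^ 2) (by positivity) (hhb k) s hs
    linarith
  refine (measureReal_mono (s₂ := ⋃ k ∈ GF d m N T, A k) ?_ (measure_ne_top _ _)).trans (prob_union _ _ A _ hA)
  intro ω hω
  have hω' : ¬ ∀ k ∈ GF d m N T,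
      |(∫ z, h k z ∂P) - avg ω (h k)| ≤ 4 * κ ^ 2 * s := hω
  push Not at hω'
  obtain ⟨k, hk, hlt⟩ := hω'
  refine Set.mem_biUnion hk ?_
  rcases lt_abs.1 hlt with h1 | h1
  · right; exact h1.le
  · left
    show 4 * κ ^ 2 * s ≤ avg ω (h k) - ∫ z, h k z ∂P
    linarith

def GoodK (d : ℕ) {n : ℕ} (P : Measure (Euc d × ℝ)) (η κ R : ℝ) (ω : Fin n → Euc d × ℝ) : Prop :=
  ∀ (K : ℕ) (θ : Params d K), (∀ x, ‖x‖ ≤ 1 → |netFun θ x| ≤ κ) →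
    ContDiffAt ℝ 2 (empLoss n (fun i => (ω i).1) (fun i => (ω i).2)) θ →
    lambdaMax (empLoss n (fun i => (ω i).1) (fun i => (ω i).2)) θ ≤ 2 / η →
    |(∫ z, (netFun θ z.1 - z.2) ^ 2 ∂P) - avg ω (fun z => (netFun θ z.1 - z.2) ^ 2)| ≤ R

lemma combine {d n : ℕ} (hd : 1 ≤ d) (hn : 0 < n) (P : Measure (Euc d × ℝ)) [IsProbabilityMeasure P]
    (hmap : P.map Prod.fst = uniformBall d) 
    (η κ ε p τ r s C δ R : ℝ) (m N T q : ℕ) (hm : 0 < m) (hN : 0 < N) (hη : 0 < η) (hκ : 0 < κ)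
    (hε0 : 0 < ε) (hε1 : ε ≤ 1) (hτ : 0 < τ) (hr : 0 ≤ r)
    (hP : ∀ᵐ z ∂P, ‖z.1‖ ≤ 1 ∧ |z.2| ≤ κ) (hq0 : 0 < q) (hq : 8 * d ≤ ε * q)
    (hp : p = (√(ε / 4) / 2) ^ (d + 1)) (hC : C = (1 / η + κ) * (2 / (ε * (p / 2) ^ 2))) (hT : κ + 3 * C ≤ τ * T)
    (e1 : (2 * q + 1) ^ d * exp (-n * p ^ 2 / 2) ≤ δ / 4) (e2 : (Zf d m).card * exp (-s) ≤ δ / 4)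
    (e3 : exp (-2 * n * r ^ 2) ≤ δ / 4) (e4 : (GF d m N T).card * (2 * exp (-2 * n * r ^ 2)) ≤ δ / 4)
    (hR : 4 * κ ^ 2 * (d * ε + (d * ε + r)) + 4 * κ ^ 2 * r + 2 * κ / (κ * ε) *
      (2 * (C ^ 2 * ((d + 1) / m) ^ 2 * (12 * 2 ^ d * ((d + 1) / m) + (2 * (12 * 2 ^ d * ((d + 1) / m)) + s / n)) / N) +
        4 * (Fintype.card (JJ d m N) * ((d + 1) * τ)) ^ 2) + 4 * κ * (κ * ε) ≤ R) :
    (Measure.pi fun _ : Fin n => P).real {ω | ¬ GoodK d P η κ R ω} ≤ δ := by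
  have hp0 : 0 < p := by rw [hp]; positivity
  have b0 := prob_supp P n _ hP
  have b1 := prob_cap hn P hmap (hP.mono fun z h => h.1) ε p hε0 hε1 q hq0 hq hp
  have b2 := prob_slab hn P hmap m hm s
  have b3 := prob_ann hn P hmap ε hε0.le hε1 r hr
  have b4 := prob_G hn P κ ε τ hκ hP m N T r hr
  set B0 := {ω : Fin n → Euc d × ℝ | ¬ ∀ i, ‖(ω i).1‖ ≤ 1 ∧ |(ω i).2| ≤ κ} with hB0
  set B1 := {ω : Fin n → Euc d × ℝ | (∀ i, ‖(ω i).1‖ ≤ 1) ∧ ¬ ∀ u : Euc d, ‖u‖ = 1 →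
      p / 2 ≤ avg (fun i => (ω i).1) (fun z => if 1 - ε / 2 < ∑ j, u j * z j then (1 : ℝ) else 0)} with hB1
  set B2 := {ω : Fin n → Euc d × ℝ | ¬ ∀ z ∈ Zf d m, avg (fun i => (ω i).1)
      ({x : Euc d | |lin (qz m z) x| ≤ (d + 1) / m}.indicator fun _ => (1 : ℝ)) ≤ 2 * (12 * 2 ^ d * ((d + 1) / m)) + s / n} with hB2
  set B3 := {ω : Fin n → Euc d × ℝ | ¬ avg (fun i => (ω i).1)
      ({x : Euc d | 1 - ε < ‖x‖}.indicator fun _ => (1 : ℝ)) ≤ d * ε + r} with hB3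
  set B4 := {ω : Fin n → Euc d × ℝ | ¬ ∀ k ∈ GF d m N T,
      |(∫ z, Hf ε (fun x => clp κ (gq τ k x)) z ∂P) - avg ω (Hf ε (fun x => clp κ (gq τ k x)))| ≤ 4 * κ ^ 2 * r} with hB4
  have hsub : {ω | ¬ GoodK d P η κ R ω} ⊆ B0 ∪ B1 ∪ B2 ∪ B3 ∪ B4 := by
    intro ω hω
    by_contra hcon
    simp only [Set.mem_union, not_or] at hcon
    obtain ⟨⟨⟨⟨h0, h1⟩, h2⟩, h3⟩, h4⟩ := hcon
    apply hω
    simp only [hB0, hB1, hB2, hB3, hB4, Set.mem_ofPred_eq, not_not, not_and] at h0 h1 h2 h3 h4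
    intro K θ hf hC2 hl
    refine (det_main hd hn P hmap ω θ η κ ε (p / 2) _ _ _ τ (κ * ε) m N T hm hN hη hκ hε0 hε1 (by positivity) hτ (by positivity)
      hP h0 hf hC2 hl (h1 fun i => (h0 i).1) h2 h3 h4 C hC hT).trans hR
  refine (measureReal_mono hsub (measure_ne_top _ _)).trans ?_
  refine (measureReal_union_le _ _).trans ?_
  have u1 := measureReal_union_le (μ := Measure.pi fun _ : Fin n => P) (B0 ∪ B1 ∪ B2) B3
  have u2 := measureReal_union_le (μ := Measure.pi fun _ : Fin n => P) (B0 ∪ B1) B2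
  have u3 := measureReal_union_le (μ := Measure.pi fun _ : Fin n => P) (B0) B1
  linarith

lemma tail_le (a δ y : ℝ) (ha : 0 < a) (hδ : 0 < δ) (h : log a + 2 + log (1 / δ) ≤ y) : a * exp (-y) ≤ δ / 4 := by
  have h4 : (4 : ℝ) ≤ exp 2 := by
    have := Real.add_one_le_exp (1 : ℝ)
    have e : exp 2 = exp 1 * exp 1 := by rw [← Real.exp_add]; norm_num
    rw [e]; nlinarith
  have h1 : a * (1 / δ) * 4 ≤ exp y := by
    calc a * (1 / δ) * 4 ≤ a * (1 / δ) * exp 2 := by gcongr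
      _ = exp (log a + 2 + log (1 / δ)) := by
          rw [Real.exp_add, Real.exp_add, Real.exp_log ha, Real.exp_log (by positivity)]; ring
      _ ≤ exp y := Real.exp_le_exp.2 h
  rw [Real.exp_neg, ← div_eq_mul_inv, div_le_iff₀ (Real.exp_pos y)]
  calc a = δ / 4 * (a * (1 / δ) * 4) := by field_simp
    _ ≤ _ := by gcongr

lemma num_neps (d : ℕ) (hd : 1 ≤ d) (n Θ ε : ℝ) (hn : 1 ≤ n) (hΘ : 1 ≤ Θ) (h0 : 0 < ε) (h1 : ε ≤ 1)
    (hE : ε ^ (2 * (d + 1)) * n = Θ ^ (2 * d)) : 1 ≤ n * ε ^ 2 := by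
  have : ε ^ (2 * (d + 1)) ≤ ε ^ 2 := pow_le_pow_of_le_one h0.le h1 (by omega)
  have h2 : (1 : ℝ) ≤ Θ ^ (2 * d) := one_le_pow₀ hΘ
  nlinarith

lemma num_theta (d : ℕ) (hd : 1 ≤ d) (n Θ ε : ℝ) (hn : 1 ≤ n) (hΘ : 1 ≤ Θ) (h0 : 0 < ε) (h1 : ε ≤ 1)
    (hE : ε ^ (2 * (d + 1)) * n = Θ ^ (2 * d)) : Θ ≤ n := by
  have h2 : Θ ^ 1 ≤ Θ ^ (2 * d) := pow_le_pow_right₀ hΘ (by omega)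
  have h3 : ε ^ (2 * (d + 1)) ≤ 1 := pow_le_one₀ h0.le h1
  rw [pow_one] at h2
  nlinarith

lemma num_inv (d : ℕ) (hd : 1 ≤ d) (n Θ ε : ℝ) (hn : 1 ≤ n) (hΘ : 1 ≤ Θ) (h0 : 0 < ε) (h1 : ε ≤ 1)
    (hE : ε ^ (2 * (d + 1)) * n = Θ ^ (2 * d)) : 1 / ε ≤ n := by
  have := num_neps d hd n Θ ε hn hΘ h0 h1 hE
  rw [div_le_iff₀ h0]
  nlinarith

lemma num_sqrt (d : ℕ) (hd : 1 ≤ d) (n Θ ε : ℝ) (hn : 1 ≤ n) (hΘ : 1 ≤ Θ) (h0 : 0 < ε) (h1 : ε ≤ 1)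
    (hE : ε ^ (2 * (d + 1)) * n = Θ ^ (2 * d)) : √n ≤ n * ε ^ (d + 1) := by
  have e : n * ε ^ (d + 1) = √n * Θ ^ d := by
    have hs : √n * ε ^ (d + 1) = Θ ^ d := by
      rw [← sq_eq_sq₀ (by positivity) (by positivity), mul_pow, Real.sq_sqrt (by linarith), ← pow_mul, ← pow_mul,
        mul_comm (d + 1) 2, mul_comm d 2, ← hE, mul_comm]
    rw [← hs]
    nth_rw 1 [← Real.mul_self_sqrt (show 0 ≤ n by linarith)]
    ring
  rw [e]
  have : (1 : ℝ) ≤ Θ ^ d := one_le_pow₀ hΘ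
  nlinarith [Real.sqrt_nonneg n]

lemma num_m (d : ℕ) (hd : 1 ≤ d) (n Θ ε : ℝ) (hn : 1 ≤ n) (hΘ : 1 ≤ Θ) (h0 : 0 < ε) (h1 : ε ≤ 1)
    (hE : ε ^ (2 * (d + 1)) * n = Θ ^ (2 * d)) (m : ℕ) (hm : m = ⌈Θ ^ 2 / ε ^ 2⌉₊) : 0 < m ∧ Θ ^ 2 / ε ^ 2 ≤ m ∧ (m : ℝ) ^ d ≤ 2 ^ d * (n * ε ^ 2) := by
  have h2 : 1 ≤ Θ ^ 2 / ε ^ 2 := by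
    rw [le_div_iff₀ (by positivity), one_mul]
    calc ε ^ 2 ≤ 1 := pow_le_one₀ h0.le h1
      _ ≤ Θ ^ 2 := one_le_pow₀ hΘ
  have h3 : Θ ^ 2 / ε ^ 2 ≤ m := hm ▸ Nat.le_ceil _
  have h4 : (m : ℝ) ≤ 2 * (Θ ^ 2 / ε ^ 2) := by
    have := (Nat.ceil_lt_add_one (show 0 ≤ Θ ^ 2 / ε ^ 2 by positivity)).le
    rw [← hm] at this; linarith
  refine ⟨by exact_mod_cast (by linarith : (0 : ℝ) < m), h3, ?_⟩
  calc (m : ℝ) ^ d ≤ (2 * (Θ ^ 2 / ε ^ 2)) ^ d := by gcongr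
    _ = 2 ^ d * (Θ ^ (2 * d) / ε ^ (2 * d)) := by rw [mul_pow, div_pow, ← pow_mul, ← pow_mul]
    _ = 2 ^ d * (n * ε ^ 2) := by
        rw [← hE]; congr 1
        rw [show 2 * (d + 1) = 2 * d + 2 by ring, pow_add]
        field_simp

lemma JJ_bound (d m : ℕ) (hm : 0 < m) : ((Zf d m).card : ℝ) ≤ (2 * (d + 1) * 3 ^ d + 3) * m ^ d ∧
    (Fintype.card (JJ d m (m ^ d)) : ℝ) ≤ (2 * (d + 1) * 3 ^ d + 3) * m ^ d := by
  have h1 : ((Zf d m).card : ℝ) ≤ (d + 1) * (2 * (2 * m + 1) ^ d) := by exact_mod_cast Zf_card d m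
  have hm1 : (1 : ℝ) ≤ m := by exact_mod_cast hm
  have h2 : (2 * (m : ℝ) + 1) ^ d ≤ (3 * m) ^ d := by gcongr; linarith
  rw [mul_pow] at h2
  have h3 : (1 : ℝ) ≤ (m : ℝ) ^ d := one_le_pow₀ hm1
  have h4 : (d + 1) * (2 * (2 * (m : ℝ) + 1) ^ d) ≤ (d + 1) * (2 * (3 ^ d * m ^ d)) := by gcongr
  rw [JJ_card]
  push_cast
  constructor <;> nlinarith

set_option maxHeartbeats 4000000 in
lemma per_kappa (d : ℕ) (hd : 1 ≤ d) : ∃ c0 : ℝ, 1 ≤ c0 ∧ ∃ c9 : ℝ, 0 < c9 ∧ ∀ (n : ℕ) (hn : 0 < n) (P : Measure (Euc d × ℝ))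
    (_ : IsProbabilityMeasure P) (hmap : P.map Prod.fst = uniformBall d) (η κ Θ ε δ ℓ : ℝ) (hη : 0 < η) (hκ : 1 ≤ κ)
    (hP : ∀ᵐ z ∂P, ‖z.1‖ ≤ 1 ∧ |z.2| ≤ κ) (hδ0 : 0 < δ) (hδ1 : δ ≤ 1) (hℓ : ℓ = 1 + log n + log (1 / δ))
    (hΘ : 1 ≤ Θ) (hε0 : 0 < ε) (hε1 : ε ≤ 1) (hE : ε ^ (2 * (d + 1)) * n = Θ ^ (2 * d)) (hA : 1 / η + κ = κ * Θ ^ (d + 3))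
    (hbig : c9 * ℓ ≤ √n),
    (Measure.pi fun _ : Fin n => P).real {ω | ¬ GoodK d P η κ (c0 * κ ^ 2 * ε * ℓ) ω} ≤ δ := by
  obtain ⟨c1, hc1⟩ : ∃ c1 : ℝ, c1 = 2 * (d + 1) * 3 ^ d + 3 := ⟨_, rfl⟩
  obtain ⟨c2, hc2⟩ : ∃ c2 : ℝ, c2 = 8 * 16 ^ (d + 1) := ⟨_, rfl⟩
  obtain ⟨c3, hc3⟩ : ∃ c3 : ℝ, c3 = (1 + 3 * c2) * (d + 1) * c1 * 2 ^ d := ⟨_, rfl⟩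
  obtain ⟨c4, hc4⟩ : ∃ c4 : ℝ, c4 = log (5 * c3) + (2 * d + 7) := ⟨_, rfl⟩
  obtain ⟨c5, hc5⟩ : ∃ c5 : ℝ, c5 = (d + 1) * (c1 * 2 ^ d) * c4 := ⟨_, rfl⟩
  obtain ⟨c6, hc6⟩ : ∃ c6 : ℝ, c6 = c5 + 4 := ⟨_, rfl⟩
  obtain ⟨c7, hc7⟩ : ∃ c7 : ℝ, c7 = log (c1 * 2 ^ d) + 4 := ⟨_, rfl⟩
  obtain ⟨c8, hc8⟩ : ∃ c8 : ℝ, c8 = d * log (16 * d + 3) + d + 3 := ⟨_, rfl⟩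
  obtain ⟨c10, hc10⟩ : ∃ c10 : ℝ, c10 = 36 * 2 ^ d * (d + 1) + 2 ^ d * c7 := ⟨_, rfl⟩
  have hd1 : (1 : ℝ) ≤ d := by exact_mod_cast hd
  have p2 : (1 : ℝ) ≤ 2 ^ d := one_le_pow₀ (by norm_num)
  have p3 : (1 : ℝ) ≤ 3 ^ d := one_le_pow₀ (by norm_num)
  have p16 : (1 : ℝ) ≤ 16 ^ (d + 1) := one_le_pow₀ (by norm_num)
  have k1 : 1 ≤ c1 := by rw [hc1]; have : (0 : ℝ) ≤ 2 * (d + 1) * 3 ^ d := by positivity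
                         linarith
  have k2 : 1 ≤ c2 := by rw [hc2]; linarith
  have k3 : 1 ≤ c3 := by
    rw [hc3]
    exact one_le_mul_of_one_le_of_one_le (one_le_mul_of_one_le_of_one_le (one_le_mul_of_one_le_of_one_le (by linarith) (by linarith)) k1) p2
  have k4 : 1 ≤ c4 := by rw [hc4]; have := Real.log_nonneg (show 1 ≤ 5 * c3 by linarith); linarith
  have k5 : 0 ≤ c5 := by rw [hc5]; positivity
  have k12 : 1 ≤ c1 * 2 ^ d := one_le_mul_of_one_le_of_one_le k1 p2
  have k6 : 4 ≤ c6 := by linarith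
  have k7 : 1 ≤ c7 := by rw [hc7]; have := Real.log_nonneg k12; linarith
  have k8 : 1 ≤ c8 := by rw [hc8]; have := mul_nonneg (show (0 : ℝ) ≤ d by positivity) (Real.log_nonneg (show (1 : ℝ) ≤ 16 * d + 3 by linarith)); linarith
  have k10 : 0 ≤ c10 := by rw [hc10]; positivity
  refine ⟨8 * d + 8 * c6 + 4 * (c2 ^ 2 * (d + 1) ^ 2 * c10) + 12, by linarith [show 0 ≤ c2 ^ 2 * (d + 1) ^ 2 * c10 by positivity],
    2 * 16 ^ (d + 1) * c8, by positivity, ?_⟩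
  intro n hn P _ hmap η κ Θ ε δ ℓ hη hκ hP hδ0 hδ1 hℓ hΘ hε0 hε1 hE hA hbig
  have hn1 : (1 : ℝ) ≤ n := by exact_mod_cast hn
  have hn0 : (0 : ℝ) < n := by linarith
  have hκ0 : 0 < κ := by linarith
  have hlogn : 0 ≤ log n := Real.log_nonneg hn1
  have hlogδ : 0 ≤ log (1 / δ) := Real.log_nonneg (by rw [le_div_iff₀ hδ0]; linarith)
  have hℓ1 : 1 ≤ ℓ := by linarith
  have f1 := num_neps d hd n Θ ε hn1 hΘ hε0 hε1 hE
  have f2 := num_theta d hd n Θ ε hn1 hΘ hε0 hε1 hE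
  have f3 := num_inv d hd n Θ ε hn1 hΘ hε0 hε1 hE
  have f4 := num_sqrt d hd n Θ ε hn1 hΘ hε0 hε1 hE
  obtain ⟨m, hm⟩ : ∃ m : ℕ, m = ⌈Θ ^ 2 / ε ^ 2⌉₊ := ⟨_, rfl⟩
  obtain ⟨f5, f6, f7⟩ := num_m d hd n Θ ε hn1 hΘ hε0 hε1 hE m hm
  have hm1 : (1 : ℝ) ≤ m := by exact_mod_cast f5
  have hmd : (1 : ℝ) ≤ (m : ℝ) ^ d := one_le_pow₀ hm1
  obtain ⟨z1, z2⟩ := JJ_bound d m f5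
  rw [← hc1] at z1 z2
  obtain ⟨J, hJ⟩ : ∃ J : ℝ, J = (Fintype.card (JJ d m (m ^ d)) : ℝ) := ⟨_, rfl⟩
  have hJ1 : 1 ≤ J := by
    rw [hJ, JJ_card]; push_cast
    have : (0 : ℝ) ≤ ((Zf d m).card : ℝ) := by positivity
    linarith
  rw [← hJ] at z2
  have hε21 : ε ^ 2 ≤ 1 := pow_le_one₀ hε0.le hε1
  have f7' : (m : ℝ) ^ d ≤ 2 ^ d * n := f7.trans (by gcongr; exact mul_le_of_le_one_right hn0.le hε21)
  -- p
  obtain ⟨p, hp⟩ : ∃ p : ℝ, p = (√(ε / 4) / 2) ^ (d + 1) := ⟨_, rfl⟩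
  have hp0 : 0 < p := by rw [hp]; positivity
  have hp2 : p ^ 2 = (ε / 16) ^ (d + 1) := by
    rw [hp, ← pow_mul, mul_comm, pow_mul, div_pow, Real.sq_sqrt (by positivity)]; congr 1; ring
  obtain ⟨C, hC⟩ : ∃ C : ℝ, C = (1 / η + κ) * (2 / (ε * (p / 2) ^ 2)) := ⟨_, rfl⟩
  have hC' : C = c2 * κ * (Θ ^ (d + 3) / ε ^ (d + 2)) := by
    rw [hC, hA, div_pow, hp2, div_pow, hc2]
    field_simp
    ring
  obtain ⟨τ, hτ⟩ : ∃ τ : ℝ, τ = κ * ε / ((d + 1) * J) := ⟨_, rfl⟩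
  have hτ0 : 0 < τ := by rw [hτ]; positivity
  have hJτ : J * ((d + 1) * τ) = κ * ε := by rw [hτ]; field_simp
  obtain ⟨T, hT⟩ : ∃ T : ℕ, T = ⌈(κ + 3 * C) / τ⌉₊ := ⟨_, rfl⟩
  have hT1 : κ + 3 * C ≤ τ * T := by
    have := Nat.le_ceil ((κ + 3 * C) / τ)
    rw [← hT, div_le_iff₀ hτ0] at this
    linarith
  have hC0 : 0 < C := by rw [hC']; positivity
  have hx : (κ + 3 * C) / τ ≤ c3 * n ^ (2 * d + 7) := by
    have e : (κ + 3 * C) / τ = (1 + 3 * c2 * (Θ ^ (d + 3) / ε ^ (d + 2))) * (1 / ε) * (d + 1) * J := by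
      rw [hτ, hC']; field_simp
    have g1 : 1 ≤ Θ ^ (d + 3) / ε ^ (d + 2) := by
      rw [le_div_iff₀ (by positivity), one_mul]
      exact (pow_le_one₀ hε0.le hε1).trans (one_le_pow₀ hΘ)
    have g2 : Θ ^ (d + 3) / ε ^ (d + 2) ≤ n ^ (2 * d + 5) := by
      calc Θ ^ (d + 3) / ε ^ (d + 2) = Θ ^ (d + 3) * (1 / ε) ^ (d + 2) := by rw [one_div, inv_pow]; rfl
        _ ≤ n ^ (d + 3) * n ^ (d + 2) := by gcongr
        _ = n ^ (2 * d + 5) := by rw [← pow_add]; congr 1; ring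
    rw [e]
    calc (1 + 3 * c2 * (Θ ^ (d + 3) / ε ^ (d + 2))) * (1 / ε) * (d + 1) * J
        ≤ ((1 + 3 * c2) * n ^ (2 * d + 5)) * n * (d + 1) * (c1 * (2 ^ d * n)) := by
          gcongr
          · have := mul_le_mul_of_nonneg_left g2 (show 0 ≤ 3 * c2 by linarith)
            have := g1.trans g2
            linarith
          · exact z2.trans (by gcongr)
      _ = c3 * n ^ (2 * d + 7) := by rw [hc3]; ring
  have hT2 : log (2 * T + 1) ≤ c4 * ℓ := by
    have g1 : (T : ℝ) ≤ c3 * n ^ (2 * d + 7) + 1 := by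
      rw [hT]
      exact (Nat.ceil_lt_add_one (by positivity)).le.trans (by linarith)
    have g2 : 1 ≤ c3 * (n : ℝ) ^ (2 * d + 7) := by
      have : (1 : ℝ) ≤ (n : ℝ) ^ (2 * d + 7) := one_le_pow₀ hn1
      exact one_le_mul_of_one_le_of_one_le k3 this
    have g3 : (2 * T + 1 : ℝ) ≤ 5 * c3 * n ^ (2 * d + 7) := by linarith
    calc log (2 * T + 1) ≤ log (5 * c3 * n ^ (2 * d + 7)) := Real.log_le_log (by positivity) g3
      _ = log (5 * c3) + (2 * d + 7) * log n := by
          rw [Real.log_mul (by positivity) (by positivity), Real.log_pow]; push_cast; rfl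
      _ ≤ c4 * ℓ := by
          have := Real.log_nonneg (show 1 ≤ 5 * c3 by linarith)
          have i1 := le_mul_of_one_le_right this hℓ1
          have i2 := mul_le_mul_of_nonneg_left (show log n ≤ ℓ by linarith) (show (0 : ℝ) ≤ 2 * d + 7 by positivity)
          rw [hc4]; linarith
  have hG : log (((GF d m (m ^ d) T).card : ℕ) : ℝ) ≤ c5 * (n * ε ^ 2) * ℓ := by
    rw [GF_card]; push_cast
    rw [Real.log_pow]; push_cast
    rw [← hJ]
    have hl0 : 0 ≤ log (2 * (T : ℝ) + 1) := Real.log_nonneg (by linarith [show (0 : ℝ) ≤ T by positivity])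
    calc (d + 1) * J * log (2 * T + 1) ≤ (d + 1) * (c1 * (2 ^ d * (n * ε ^ 2))) * (c4 * ℓ) := by
          gcongr
          exact z2.trans (by gcongr)
      _ = _ := by rw [hc5]; ring
  have hGpos : (0 : ℝ) < (GF d m (m ^ d) T).card := by rw [GF_card]; positivity
  have hr : c5 * (n * ε ^ 2) * ℓ + 1 + 2 + log (1 / δ) ≤ 2 * n * (c6 * ε * ℓ) ^ 2 := by
    have g1 : c5 * (n * ε ^ 2) * ℓ + 1 + 2 + log (1 / δ) ≤ c6 * (n * ε ^ 2 * ℓ) := by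
      have : ℓ ≤ n * ε ^ 2 * ℓ := le_mul_of_one_le_left (by linarith) f1
      rw [hc6]; linarith
    have g2 : 1 ≤ c6 * ℓ := one_le_mul_of_one_le_of_one_le (by linarith) hℓ1
    calc _ ≤ c6 * (n * ε ^ 2 * ℓ) := g1
      _ ≤ (c6 * (n * ε ^ 2 * ℓ)) * (2 * (c6 * ℓ)) := by
          apply le_mul_of_one_le_right (by rw [hc6]; positivity); linarith
      _ = _ := by ring
  have hlog2 : log 2 ≤ 1 := by have := Real.log_two_lt_d9; linarith
  obtain ⟨q, hq⟩ : ∃ q : ℕ, q = ⌈8 * d / ε⌉₊ := ⟨_, rfl⟩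
  have hq1 : 8 * (d : ℝ) ≤ ε * q := by
    have := Nat.le_ceil (8 * d / ε)
    rw [← hq, div_le_iff₀ hε0] at this
    linarith
  have hq0 : 0 < q := by
    rcases Nat.eq_zero_or_pos q with h | h
    · rw [h] at hq1; norm_num at hq1; linarith
    · exact h
  have hq2 : (2 * q + 1 : ℝ) ≤ (16 * d + 3) * n := by
    have g1 : (q : ℝ) ≤ 8 * d / ε + 1 := by rw [hq]; exact (Nat.ceil_lt_add_one (by positivity)).le
    have g2 : 8 * d / ε ≤ 8 * d * n := by
      rw [div_eq_mul_one_div]; gcongr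
    linarith
  refine combine hd hn P hmap η κ ε p τ (c6 * ε * ℓ) (c7 * ℓ) C δ _ m (m ^ d) T q f5 (by positivity) hη hκ0 hε0 hε1 hτ0 (by positivity) hP hq0 hq1
    hp hC hT1 ?_ ?_ ?_ ?_ ?_
  · rw [show -(n : ℝ) * p ^ 2 / 2 = -(n * p ^ 2 / 2) by ring]
    refine tail_le _ _ _ (by positivity) hδ0 ?_
    rw [Real.log_pow]
    have g1 : log (2 * q + 1) ≤ log (16 * d + 3) + log n := by
      rw [← Real.log_mul (by positivity) (by positivity)]
      exact Real.log_le_log (by positivity) hq2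
    have g2 : n * p ^ 2 / 2 = n * ε ^ (d + 1) / (2 * 16 ^ (d + 1)) := by rw [hp2, div_pow]; field_simp
    have g3 : c8 * ℓ ≤ n * ε ^ (d + 1) / (2 * 16 ^ (d + 1)) := by
      rw [le_div_iff₀ (by positivity)]
      linarith
    rw [g2]
    refine le_trans ?_ g3
    have g4 : d * log (2 * q + 1) ≤ d * (log (16 * d + 3) + log n) := by gcongr
    have := Real.log_nonneg (show (1 : ℝ) ≤ 16 * d + 3 by linarith)
    have g5 : (0 : ℝ) ≤ d * log (16 * d + 3) := by positivity
    rw [hc8, hℓ]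
    linarith [mul_nonneg g5 hlogn, mul_nonneg g5 hlogδ, mul_nonneg (show (0 : ℝ) ≤ d by positivity) hlogδ]
  · have hZ : (Zf d m).card ≤ (c1 * 2 ^ d * n) := z1.trans (by rw [mul_assoc]; gcongr)
    refine le_trans (mul_le_mul_of_nonneg_right hZ (Real.exp_pos _).le) ?_
    refine tail_le _ _ _ (by positivity) hδ0 ?_
    rw [Real.log_mul (by positivity) (by positivity), hc7]
    have := le_mul_of_one_le_right (Real.log_nonneg k12) hℓ1
    linarith
  · have := tail_le 1 δ (2 * n * (c6 * ε * ℓ) ^ 2) one_pos hδ0 (by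
      rw [Real.log_one]
      have : 0 ≤ c5 * (n * ε ^ 2) * ℓ := by positivity
      linarith)
    rw [one_mul] at this
    convert this using 2; ring
  · have := tail_le (2 * (GF d m (m ^ d) T).card) δ (2 * n * (c6 * ε * ℓ) ^ 2) (by positivity) hδ0 (by
      rw [Real.log_mul (by positivity) (by positivity)]
      linarith)
    convert this using 1
    rw [show -2 * (n : ℝ) * (c6 * ε * ℓ) ^ 2 = -(2 * n * (c6 * ε * ℓ) ^ 2) by ring]; ring
  · rw [← hJ, hJτ]
    have hmd1 : (m : ℝ) ≤ (m : ℝ) ^ d := by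
      calc (m : ℝ) = (m : ℝ) ^ 1 := (pow_one _).symm
        _ ≤ _ := pow_le_pow_right₀ hm1 hd
    have g1 : c7 * ℓ / n ≤ 2 ^ d * c7 * ℓ / m := by
      rw [div_le_div_iff₀ hn0 (by linarith)]
      have : (m : ℝ) ≤ 2 ^ d * n := hmd1.trans f7'
      calc c7 * ℓ * m ≤ c7 * ℓ * (2 ^ d * n) := by gcongr
        _ = _ := by ring
    have g2 : 12 * 2 ^ d * ((d + 1) / m) + (2 * (12 * 2 ^ d * ((d + 1) / m)) + c7 * ℓ / n) ≤ c10 * ℓ / m := by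
      have : 36 * 2 ^ d * ((d + 1) / (m : ℝ)) ≤ 36 * 2 ^ d * (d + 1) * ℓ / m := by
        rw [mul_div_assoc', div_le_div_iff_of_pos_right (by linarith)]
        exact le_mul_of_one_le_right (by positivity) hℓ1
      have e : c10 * ℓ / m = 36 * 2 ^ d * (d + 1) * ℓ / m + 2 ^ d * c7 * ℓ / m := by rw [hc10]; ring
      rw [e]; linarith
    have g3 : C ^ 2 / m ^ (d + 3) ≤ c2 ^ 2 * κ ^ 2 * ε ^ 2 := by
      rw [div_le_iff₀ (by positivity)]
      calc C ^ 2 = c2 ^ 2 * κ ^ 2 * ε ^ 2 * (Θ ^ 2 / ε ^ 2) ^ (d + 3) := by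
            rw [hC', mul_pow, mul_pow, div_pow, div_pow, ← pow_mul, ← pow_mul, ← pow_mul, ← pow_mul]
            rw [show (d + 3) * 2 = 2 * (d + 3) by ring, show 2 * (d + 3) = (d + 2) * 2 + 2 by ring, pow_add ε]
            field_simp
        _ ≤ _ := by gcongr
    have g4 : C ^ 2 * ((d + 1) / m) ^ 2 * (12 * 2 ^ d * ((d + 1) / m) + (2 * (12 * 2 ^ d * ((d + 1) / m)) + c7 * ℓ / n)) / ((m ^ d : ℕ) : ℝ)
        ≤ c2 ^ 2 * κ ^ 2 * ε ^ 2 * ((d + 1) ^ 2 * c10 * ℓ) := by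
      calc _ ≤ C ^ 2 * ((d + 1) / m) ^ 2 * (c10 * ℓ / m) / ((m ^ d : ℕ) : ℝ) := by gcongr
        _ = C ^ 2 / m ^ (d + 3) * ((d + 1) ^ 2 * c10 * ℓ) := by
            push_cast; rw [pow_add (m : ℝ)]; field_simp
        _ ≤ _ := by gcongr
    have g5 : 2 * κ / (κ * ε) = 2 / ε := by field_simp
    rw [g5]
    have g6 : 2 / ε * (2 * (C ^ 2 * ((d + 1) / m) ^ 2 * (12 * 2 ^ d * ((d + 1) / m) + (2 * (12 * 2 ^ d * ((d + 1) / m)) + c7 * ℓ / n)) / ((m ^ d : ℕ) : ℝ)) + 4 * (κ * ε) ^ 2)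
        ≤ 4 * (c2 ^ 2 * (d + 1) ^ 2 * c10) * (κ ^ 2 * ε * ℓ) + 8 * κ ^ 2 * ε := by
      calc _ ≤ 2 / ε * (2 * (c2 ^ 2 * κ ^ 2 * ε ^ 2 * ((d + 1) ^ 2 * c10 * ℓ)) + 4 * (κ * ε) ^ 2) := by gcongr
        _ = _ := by field_simp; ring
    have g7 : κ ^ 2 * ε ≤ κ ^ 2 * ε * ℓ := le_mul_of_one_le_right (by positivity) hℓ1
    have g8 : d * (κ ^ 2 * ε) ≤ d * (κ ^ 2 * ε * ℓ) := by gcongr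
    linarith [g6, g7, g8]

lemma gap_triv {d n : ℕ} (hn : 0 < n) (P : Measure (Euc d × ℝ)) [IsProbabilityMeasure P] (κ : ℝ) 
    (hP : ∀ᵐ z ∂P, ‖z.1‖ ≤ 1 ∧ |z.2| ≤ κ) (ω : Fin n → Euc d × ℝ) (hω : ∀ i, ‖(ω i).1‖ ≤ 1 ∧ |(ω i).2| ≤ κ)
    (f : Euc d → ℝ) (hf : ∀ x, ‖x‖ ≤ 1 → |f x| ≤ κ) :
    |(∫ z, (f z.1 - z.2) ^ 2 ∂P) - avg ω (fun z => (f z.1 - z.2) ^ 2)| ≤ 4 * κ ^ 2 := by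
  have hn' : (0 : ℝ) < n := by exact_mod_cast hn
  have hB : ∀ z : Euc d × ℝ, ‖z.1‖ ≤ 1 ∧ |z.2| ≤ κ → (f z.1 - z.2) ^ 2 ≤ 4 * κ ^ 2 := by
    intro z hz
    have : |f z.1 - z.2| ≤ 2 * κ := (abs_sub _ _).trans (by linarith [hf _ hz.1, hz.2])
    calc (f z.1 - z.2) ^ 2 = |f z.1 - z.2| ^ 2 := (sq_abs _).symm
      _ ≤ (2 * κ) ^ 2 := by gcongr
      _ = _ := by ring
  have a1 : 0 ≤ ∫ z, (f z.1 - z.2) ^ 2 ∂P := integral_nonneg fun z => sq_nonneg _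
  have a2 : ∫ z, (f z.1 - z.2) ^ 2 ∂P ≤ 4 * κ ^ 2 := by
    have := integral_mono_of_nonneg (μ := P) (f := fun z => (f z.1 - z.2) ^ 2) (g := fun _ => 4 * κ ^ 2)
      (ae_of_all _ fun z => sq_nonneg _) (integrable_const _) (hP.mono hB)
    simpa using this
  have a3 : 0 ≤ avg ω (fun z => (f z.1 - z.2) ^ 2) := by
    unfold avg
    exact mul_nonneg (by positivity) (Finset.sum_nonneg fun i _ => sq_nonneg _)
  have a4 : avg ω (fun z => (f z.1 - z.2) ^ 2) ≤ 4 * κ ^ 2 := by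
    unfold avg
    have : ∑ i, (f (ω i).1 - (ω i).2) ^ 2 ≤ ∑ _i : Fin n, 4 * κ ^ 2 := Finset.sum_le_sum fun i _ => hB _ (hω i)
    rw [one_div, inv_mul_le_iff₀ hn']
    simpa using this
  rw [abs_le]; constructor <;> linarith

lemma per_kappa2 (d : ℕ) (hd : 1 ≤ d) : ∃ c : ℝ, 1 ≤ c ∧ ∀ (n : ℕ), 0 < n → ∀ (P : Measure (Euc d × ℝ)),
    IsProbabilityMeasure P → P.map Prod.fst = uniformBall d → ∀ (η κ Θ ε δ ℓ : ℝ), 0 < η → 1 ≤ κ →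
    (∀ᵐ z ∂P, ‖z.1‖ ≤ 1 ∧ |z.2| ≤ κ) → 0 < δ → δ ≤ 1 → ℓ = 1 + log n + log (1 / δ) →
    1 ≤ Θ → 0 < ε → ε ^ (2 * (d + 1)) * n = Θ ^ (2 * d) → 1 / η + κ = κ * Θ ^ (d + 3) →
    (Measure.pi fun _ : Fin n => P).real {ω | ¬ GoodK d P η κ (c * κ ^ 2 * ε * ℓ) ω} ≤ δ := by
  obtain ⟨c0, hc0, c9, hc9, H⟩ := per_kappa d hd
  refine ⟨c0 + 4 + 4 * c9, by linarith, ?_⟩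
  intro n hn P hPr hmap η κ Θ ε δ ℓ hη hκ hP hδ0 hδ1 hℓ hΘ hε0 hE hA
  have hn1 : (1 : ℝ) ≤ n := by exact_mod_cast hn
  have hlogn : 0 ≤ log n := Real.log_nonneg hn1
  have hlogδ : 0 ≤ log (1 / δ) := Real.log_nonneg (by rw [le_div_iff₀ hδ0]; linarith)
  have hℓ1 : 1 ≤ ℓ := by linarith
  by_cases hbig : ε ≤ 1 ∧ c9 * ℓ ≤ √n
  · refine le_trans (measureReal_mono ?_ (measure_ne_top _ _)) (H n hn P hPr hmap η κ Θ ε δ ℓ hη hκ hP hδ0 hδ1 hℓ hΘ hε0 hbig.1 hE hA hbig.2)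
    intro ω hω hg
    apply hω
    intro K θ h1 h2 h3
    refine (hg K θ h1 h2 h3).trans ?_
    gcongr
    linarith
  · have key : 4 * κ ^ 2 ≤ (c0 + 4 + 4 * c9) * κ ^ 2 * ε * ℓ := by
      suffices h : 4 ≤ (c0 + 4 + 4 * c9) * (ε * ℓ) by
        calc 4 * κ ^ 2 ≤ (c0 + 4 + 4 * c9) * (ε * ℓ) * κ ^ 2 := by gcongr
          _ = _ := by ring
      by_cases h1 : ε ≤ 1
      · have h2 : √n < c9 * ℓ := by
          by_contra h; exact hbig ⟨h1, not_lt.1 h⟩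
        have h3 := num_neps d hd n Θ ε hn1 hΘ hε0 h1 hE
        have h4 : 1 ≤ √n * ε := by
          have : 1 ≤ √(n * ε ^ 2) := Real.one_le_sqrt.2 h3
          rwa [Real.sqrt_mul (by linarith), Real.sqrt_sq hε0.le] at this
        have h5 : 1 ≤ c9 * ℓ * ε := h4.trans (by gcongr)
        have h6 : 0 < ε * ℓ := by positivity
        have h7 : 0 ≤ (c0 + 4) * (ε * ℓ) := by positivity
        linarith
      · have h2 : 1 ≤ ε * ℓ := one_le_mul_of_one_le_of_one_le (not_le.1 h1).le hℓ1
        have h7 : 0 ≤ (c0 + 4 * c9) * (ε * ℓ) := by positivity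
        linarith
    have h0 := prob_supp P n _ hP
    refine le_trans (le_trans (measureReal_mono ?_ (measure_ne_top _ _)) h0.le) hδ0.le
    intro ω hω hg
    apply hω
    intro K θ h1 h2 h3
    exact (gap_triv hn P κ hP ω hg _ h1).trans key

lemma exists_theta (d : ℕ) (hd : 1 ≤ d) (n η κ : ℝ) (hn : 1 ≤ n) (hη : 0 < η) (hκ : 1 ≤ κ) : ∃ Θ ε : ℝ, 1 ≤ Θ ∧ 0 < ε ∧
    ε ^ (2 * (d + 1)) * n = Θ ^ (2 * d) ∧ 1 / η + κ = κ * Θ ^ (d + 3) ∧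
    ε ≤ (1 / η + κ) ^ ((d : ℝ) / ((d : ℝ) ^ 2 + 4 * (d : ℝ) + 3)) * n ^ (-(1 : ℝ) / (2 * (d : ℝ) + 2)) := by
  have hη' : 0 < 1 / η := by positivity
  have hκ0 : 0 < κ := by linarith
  have hn0 : 0 < n := by linarith
  set A := (1 / η + κ) / κ with hA
  have hA1 : 1 ≤ A := by rw [hA, le_div_iff₀ hκ0]; linarith
  have hA0 : 0 < A := by linarith
  set Θ := A ^ ((1 : ℝ) / (d + 3)) with hΘ
  have hΘ1 : 1 ≤ Θ := Real.one_le_rpow hA1 (by positivity)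
  have hΘ0 : 0 < Θ := by linarith
  refine ⟨Θ, (Θ ^ (2 * d) / n) ^ ((1 : ℝ) / (2 * (d + 1))), hΘ1, by positivity, ?_, ?_, ?_⟩
  · rw [← Real.rpow_mul_natCast (by positivity)]
    have : (1 : ℝ) / (2 * (d + 1)) * ((2 * (d + 1) : ℕ) : ℝ) = 1 := by push_cast; field_simp
    rw [this, Real.rpow_one]; field_simp
  · rw [hΘ, ← Real.rpow_mul_natCast hA0.le]
    have : (1 : ℝ) / (d + 3) * ((d + 3 : ℕ) : ℝ) = 1 := by push_cast; field_simp
    rw [this, Real.rpow_one, hA]; field_simp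
  · rw [Real.div_rpow (by positivity) hn0.le, div_eq_mul_inv, ← Real.rpow_neg hn0.le]
    have e1 : -(1 / (2 * ((d : ℝ) + 1))) = -(1 : ℝ) / (2 * (d : ℝ) + 2) := by field_simp
    rw [e1]
    gcongr
    rw [hΘ, ← Real.rpow_mul_natCast hA0.le, ← Real.rpow_mul hA0.le]
    have e2 : (1 : ℝ) / (d + 3) * ((2 * d : ℕ) : ℝ) * (1 / (2 * (d + 1))) = (d : ℝ) / ((d : ℝ) ^ 2 + 4 * (d : ℝ) + 3) := by
      push_cast
      rw [show (d : ℝ) ^ 2 + 4 * (d : ℝ) + 3 = (d + 1) * (d + 3) by ring]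
      field_simp
    rw [e2]
    refine Real.rpow_le_rpow hA0.le ?_ (by positivity)
    rw [hA]
    exact div_le_self (by positivity) hκ

lemma rhs_small (d : ℕ) (hd : 1 ≤ d) (n M : ℝ) (hn : 1 ≤ n) (hM : n ≤ M) :
    M ^ 2 ≤ M ^ (3 * ((d : ℝ) + 2) / ((d : ℝ) + 3)) * n ^ (-(1 : ℝ) / (2 * (d : ℝ) + 2)) := by
  have hM1 : 1 ≤ M := hn.trans hM
  have hd1 : (1 : ℝ) ≤ d := by exact_mod_cast hd
  have h1 : M ^ (-(1 : ℝ) / (2 * (d : ℝ) + 2)) ≤ n ^ (-(1 : ℝ) / (2 * (d : ℝ) + 2)) :=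
    Real.rpow_le_rpow_of_nonpos (by linarith) hM (by
      apply div_nonpos_of_nonpos_of_nonneg (by norm_num) (by positivity))
  refine le_trans ?_ (mul_le_mul_of_nonneg_left h1 (by positivity))
  rw [← Real.rpow_add (by linarith), ← Real.rpow_natCast]
  refine Real.rpow_le_rpow_of_exponent_le hM1 ?_
  push_cast
  rw [div_add_div _ _ (by positivity) (by positivity), le_div_iff₀ (by positivity)]
  nlinarith

lemma rhs_pow (d : ℕ) (M : ℝ) (hM : 1 ≤ M) : M ^ 2 ≤ M ^ (3 * ((d : ℝ) + 2) / ((d : ℝ) + 3)) := by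
  rw [← Real.rpow_natCast]
  refine Real.rpow_le_rpow_of_exponent_le hM ?_
  push_cast
  rw [le_div_iff₀ (by positivity)]
  have : (0 : ℝ) ≤ d := by positivity
  linarith

/-- **Generalization gap of stable minima (upper bound of Theorem `thm:generalization-gap`).** -/
theorem generalization_gap_stable_minima
    (d : ℕ) (hd : 1 ≤ d) :
    ∃ c > (0 : ℝ), ∃ a ≥ (0 : ℝ),
      ∀ (η D δ : ℝ), 0 < η → 0 < D → δ ∈ Set.Ioo (0 : ℝ) 1 →
      ∀ (n : ℕ), 0 < n →
      ∀ (P : Measure (Euc d × ℝ)), IsProbabilityMeasure P →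
        P ((Metric.closedBall (0 : Euc d) 1 ×ˢ Set.Icc (-D) D)ᶜ) = 0 →
        P.map Prod.fst = uniformBall d →
        ENNReal.ofReal (1 - δ) ≤
          Measure.pi (fun _ : Fin n => P)
            {ω | ∀ f : Euc d → ℝ,
              FStable d η (fun i => (ω i).1) (fun i => (ω i).2) f →
              |(∫ z, (f z.1 - z.2) ^ 2 ∂P) -
                  (1 / (n : ℝ)) * ∑ i, (f (ω i).1 - (ω i).2) ^ 2| ≤
                c * (1 + Real.log n + Real.log (1 / δ)) ^ a *
                  (1 / η - 1 / 2 +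
                      4 * max D (max (⨆ z : Metric.closedBall (0 : Euc d) 1, |f ↑z|) 1)) ^
                    ((d : ℝ) / ((d : ℝ) ^ 2 + 4 * (d : ℝ) + 3)) *
                  (max D (max (⨆ z : Metric.closedBall (0 : Euc d) 1, |f ↑z|) 1)) ^
                    (3 * ((d : ℝ) + 2) / ((d : ℝ) + 3)) *
                  (n : ℝ) ^ (-(1 : ℝ) / (2 * (d : ℝ) + 2))} := by
  obtain ⟨c, hc1, H⟩ := per_kappa2 d hd
  refine ⟨8 * c, by linarith, 1, by norm_num, ?_⟩
  intro η D δ hη hD hδ n hn P hPr hsupp hmap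
  obtain ⟨hδ0, hδ1⟩ := hδ
  have hn1 : (1 : ℝ) ≤ n := by exact_mod_cast hn
  have hn0 : (0 : ℝ) < n := by linarith
  have hη' : 0 < 1 / η := by positivity
  have hlogn : 0 ≤ log n := Real.log_nonneg hn1
  have hlogδ : 0 ≤ log (1 / δ) := Real.log_nonneg (by rw [le_div_iff₀ hδ0]; linarith)
  have hPD : ∀ᵐ z ∂P, ‖z.1‖ ≤ 1 ∧ |z.2| ≤ D := by
    have : ∀ᵐ z ∂P, z ∈ Metric.closedBall (0 : Euc d) 1 ×ˢ Set.Icc (-D) D := by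
      rw [ae_iff]; exact hsupp
    filter_upwards [this] with z hz
    exact ⟨by simpa using hz.1, abs_le.2 hz.2⟩
  have hex : ∀ κ : ℕ, 1 ≤ κ → ∃ Θ ε : ℝ, 1 ≤ Θ ∧ 0 < ε ∧
    ε ^ (2 * (d + 1)) * n = Θ ^ (2 * d) ∧ 1 / η + (κ : ℝ) = κ * Θ ^ (d + 3) ∧
    ε ≤ (1 / η + κ) ^ ((d : ℝ) / ((d : ℝ) ^ 2 + 4 * (d : ℝ) + 3)) * (n : ℝ) ^ (-(1 : ℝ) / (2 * (d : ℝ) + 2)) :=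
    fun κ hκ => exists_theta d hd n η κ hn1 hη (by exact_mod_cast hκ)
  choose! Θ ε h1 h2 h3 h4 h5 using hex
  set ℓ : ℝ := 1 + log n + log (1 / (δ / n)) with hℓ
  set L : ℝ := 1 + log n + log (1 / δ) with hL
  have hℓL : ℓ ≤ 2 * L := by
    have : log (1 / (δ / n)) = log (1 / δ) + log n := by
      rw [← Real.log_mul (by positivity) (by positivity)]; congr 1; field_simp
    rw [hℓ, this]; linarith
  have hL1 : 1 ≤ L := by linarith
  set μ := Measure.pi fun _ : Fin n => P with hμ
  let B : ℕ → Set (Fin n → Euc d × ℝ) := fun κ => {ω | ¬ GoodK d P η κ (c * (κ : ℝ) ^ 2 * ε κ * ℓ) ω}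
  let F : Finset ℕ := (Finset.Icc 1 n).filter fun κ => D ≤ κ
  let B0 : Set (Fin n → Euc d × ℝ) := {ω | ¬ ∀ i, ‖(ω i).1‖ ≤ 1 ∧ |(ω i).2| ≤ D}
  have hB0 : μ.real B0 = 0 := prob_supp P n _ hPD
  have hB : ∀ κ ∈ F, μ.real (B κ) ≤ δ / n := by
    intro κ hκ
    simp only [F, Finset.mem_filter, Finset.mem_Icc] at hκ
    obtain ⟨⟨hκ1, hκn⟩, hκD⟩ := hκ
    refine H n hn P hPr hmap η κ (Θ κ) (ε κ) (δ / n) ℓ hη (by exact_mod_cast hκ1) ?_ (by positivity) ?_ hℓ (h1 κ hκ1) (h2 κ hκ1) (h3 κ hκ1) (h4 κ hκ1)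
    · filter_upwards [hPD] with z hz
      exact ⟨hz.1, hz.2.trans hκD⟩
    · rw [div_le_one hn0]; linarith
  have hBad : μ.real (B0 ∪ ⋃ κ ∈ F, B κ) ≤ δ := by
    refine (measureReal_union_le _ _).trans ?_
    have u := prob_union μ F B _ hB
    have hF : (F.card : ℝ) ≤ n := by
      have : F.card ≤ n := (Finset.card_filter_le _ _).trans (by simp)
      exact_mod_cast this
    have : (F.card : ℝ) * (δ / n) ≤ n * (δ / n) := by gcongr
    have e : n * (δ / n) = δ := by field_simp
    linarith
  have fin : ∀ S : Set (Fin n → Euc d × ℝ), Sᶜ ⊆ (B0 ∪ ⋃ κ ∈ F, B κ) → ENNReal.ofReal (1 - δ) ≤ μ S := by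
    intro S hS
    apply ENNReal.ofReal_le_of_le_toReal
    have e1 : μ.real Set.univ = 1 := probReal_univ
    have e2 : μ.real Set.univ ≤ μ.real S + μ.real Sᶜ := by
      rw [← Set.union_compl_self S]; exact measureReal_union_le _ _
    have e3 : μ.real Sᶜ ≤ δ := (measureReal_mono hS (measure_ne_top _ _)).trans hBad
    show 1 - δ ≤ μ.real S
    linarith
  apply fin
  intro ω hω
  by_contra hcon
  apply hω
  simp only [Set.mem_union, not_or] at hcon
  obtain ⟨hc0, hcB⟩ := hcon
  simp only [B0, Set.mem_ofPred_eq, not_not] at hc0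
  rintro f ⟨K, θ, hfθ, hC2, hl⟩
  obtain rfl : f = netFun θ := funext hfθ
  have hbdd : BddAbove (Set.range fun z : Metric.closedBall (0 : Euc d) 1 => |netFun θ ↑z|) := by
    have := (isCompact_closedBall (0 : Euc d) 1).bddAbove_image (f := fun z => |netFun θ z|) (netFun_continuous θ).abs.continuousOn
    rwa [Set.image_eq_range] at this
  have hsup : ∀ x : Euc d, ‖x‖ ≤ 1 → |netFun θ x| ≤ ⨆ z : Metric.closedBall (0 : Euc d) 1, |netFun θ ↑z| := by
    intro x hx
    exact le_ciSup hbdd ⟨x, by simpa using hx⟩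
  set M := max D (max (⨆ z : Metric.closedBall (0 : Euc d) 1, |netFun θ ↑z|) 1) with hM
  have hM1 : 1 ≤ M := (le_max_right _ _).trans (le_max_right _ _)
  have hMD : D ≤ M := le_max_left _ _
  have hMf : ∀ x : Euc d, ‖x‖ ≤ 1 → |netFun θ x| ≤ M := fun x hx =>
    (hsup x hx).trans ((le_max_left _ _).trans (le_max_right _ _))
  rw [Real.rpow_one]
  show |(∫ z, (netFun θ z.1 - z.2) ^ 2 ∂P) - avg ω (fun z => (netFun θ z.1 - z.2) ^ 2)| ≤ _
  set E1 : ℝ := (d : ℝ) / ((d : ℝ) ^ 2 + 4 * (d : ℝ) + 3) with hE1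
  have hE10 : 0 ≤ E1 := by positivity
  have hbase : 1 ≤ (1 / η - 1 / 2 + 4 * M) ^ E1 := Real.one_le_rpow (by linarith) hE10
  by_cases hκn : ⌈M⌉₊ ≤ n
  · set κ := ⌈M⌉₊ with hκ
    have g1 : M ≤ κ := Nat.le_ceil M
    have g2 : (κ : ℝ) ≤ M + 1 := (Nat.ceil_lt_add_one (by linarith)).le
    have hκ1 : 1 ≤ κ := by exact_mod_cast (hM1.trans g1)
    have hκF : κ ∈ F := by
      simp only [F, Finset.mem_filter, Finset.mem_Icc]
      exact ⟨⟨hκ1, hκn⟩, hMD.trans g1⟩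
    have hgood : GoodK d P η κ (c * (κ : ℝ) ^ 2 * ε κ * ℓ) ω := by
      by_contra h
      exact hcB (Set.mem_biUnion hκF h)
    refine (hgood K θ (fun x hx => (hMf x hx).trans g1) hC2 hl).trans ?_
    have g3 : ε κ ≤ (1 / η - 1 / 2 + 4 * M) ^ E1 * (n : ℝ) ^ (-(1 : ℝ) / (2 * (d : ℝ) + 2)) := by
      refine (h5 κ hκ1).trans ?_
      refine mul_le_mul_of_nonneg_right ?_ (by positivity)
      exact Real.rpow_le_rpow (by positivity) (by linarith) hE10
    have g4 : (κ : ℝ) ^ 2 ≤ 4 * M ^ (3 * ((d : ℝ) + 2) / ((d : ℝ) + 3)) := by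
      calc (κ : ℝ) ^ 2 ≤ (2 * M) ^ 2 := by gcongr; linarith
        _ = 4 * M ^ 2 := by ring
        _ ≤ _ := by gcongr; exact rhs_pow d M hM1
    have hε0 := h2 κ hκ1
    have hb0 : 0 ≤ (1 / η - 1 / 2 + 4 * M) ^ E1 := by linarith
    have hℓ0 : 0 ≤ ℓ := by
      have : 0 ≤ log (1 / (δ / n)) := Real.log_nonneg (by rw [le_div_iff₀ (by positivity), one_mul, div_le_one hn0]; linarith)
      linarith
    have hq0 : 0 ≤ (1 / η - 1 / 2 + 4 * M) ^ E1 * (n : ℝ) ^ (-(1 : ℝ) / (2 * (d : ℝ) + 2)) := by positivity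
    calc c * (κ : ℝ) ^ 2 * ε κ * ℓ ≤ c * (4 * M ^ (3 * ((d : ℝ) + 2) / ((d : ℝ) + 3))) *
          ((1 / η - 1 / 2 + 4 * M) ^ E1 * (n : ℝ) ^ (-(1 : ℝ) / (2 * (d : ℝ) + 2))) * (2 * L) := by
          refine mul_le_mul (mul_le_mul (mul_le_mul_of_nonneg_left g4 (by linarith)) g3 hε0.le (by positivity)) hℓL hℓ0 (by positivity)
      _ = _ := by ring
  · have g1 : (n : ℝ) ≤ M := (Nat.lt_ceil.1 (not_le.1 hκn)).le
    refine (gap_triv hn P M (hPD.mono fun z hz => ⟨hz.1, hz.2.trans hMD⟩) ω (fun i => ⟨(hc0 i).1, (hc0 i).2.trans hMD⟩) _ hMf).trans ?_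
    have g2 := rhs_small d hd n M hn1 g1
    have g3 : 4 ≤ 8 * c * L * (1 / η - 1 / 2 + 4 * M) ^ E1 := by
      have : 1 ≤ c * L * (1 / η - 1 / 2 + 4 * M) ^ E1 :=
        one_le_mul_of_one_le_of_one_le (one_le_mul_of_one_le_of_one_le hc1 hL1) hbase
      linarith
    rw [mul_assoc _ (M ^ (3 * ((d : ℝ) + 2) / ((d : ℝ) + 3)))]
    exact mul_le_mul g3 g2 (by positivity) (by linarith)

end
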